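/- Let 2 ≤ n_1 ≤ ⋯ ≤ n_r be integers and let X(ℂP^n, n_1,…,n_r) be the quotient of ℂP^n × S^{n_1} × ⋯ × S^{n_r} by the identification (y, x_1,…,x_r) ∼ (τ(y), −x_1,…,−x_r), where τ is complex conjugation on ℂP^n. Then cat(X(ℂP^n, n_1,…,n_r)) = n + n_1 + r. -/

import Mathlib

open Set

namespace Paper

/-- `X` admits a categorical cover of size `k`. -/
def HasCatCover (X : Type*) [TopologicalSpace X] (k : ℕ) : Prop :=
  ∃ U : Fin k → Set X,
    (∀ i, IsOpen (U i)) ∧ (⋃ i, U i) = univ ∧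
    ∀ i, (⟨Subtype.val, continuous_subtype_val⟩ : C(U i, X)).Nullhomotopic

/-- The Lusternik–Schnirelmann category of `X` (unreduced convention). -/
noncomputable def cat (X : Type*) [TopologicalSpace X] : ℕ∞ :=
  sInf {k : ℕ∞ | ∃ m : ℕ, k = m ∧ HasCatCover X m}

/-- Complex projective `n`-space: the quotient of the nonzero vectors of `ℂ^{n+1}`
by the scalar action of `ℂ`. -/
def CP (n : ℕ) : Type :=
  Quot (fun v w : {v : Fin (n + 1) → ℂ // v ≠ 0} =>
    ∃ c : ℂ, (w : Fin (n + 1) → ℂ) = c • (v : Fin (n + 1) → ℂ))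

noncomputable instance (n : ℕ) : TopologicalSpace (CP n) := by
  unfold CP; infer_instance

/-- The complex-conjugation involution `[z_0 : ⋯ : z_n] ↦ [z̄_0 : ⋯ : z̄_n]` of `ℂP^n`. -/
noncomputable def cpConj (n : ℕ) : CP n → CP n :=
  Quot.map
    (fun v => ⟨fun i => starRingEnd ℂ ((v : Fin (n + 1) → ℂ) i), by
      intro h0
      apply v.2
      funext i
      have := congrFun h0 i
      simpa using this⟩)
    (by
      rintro v w ⟨c, hc⟩
      refine ⟨starRingEnd ℂ c, ?_⟩
      funext i
      simp [hc, Pi.smul_apply, smul_eq_mul, map_mul])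

/-- The unit sphere `S^n ⊂ ℝ^{n+1}`. -/
abbrev Sph (n : ℕ) : Type :=
  (Metric.sphere (0 : EuclideanSpace ℝ (Fin (n + 1))) 1 : Set (EuclideanSpace ℝ (Fin (n + 1))))

/-- The antipodal involution of the sphere `S^n`. -/
noncomputable def negSph (n : ℕ) : Sph n → Sph n := fun x =>
  ⟨-(x : EuclideanSpace ℝ (Fin (n + 1))), by
    have hx : ‖(x : EuclideanSpace ℝ (Fin (n + 1)))‖ = 1 :=
      mem_sphere_zero_iff_norm.mp x.2
    simp [mem_sphere_zero_iff_norm, hx]⟩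

/-- The generalized projective product space `X(ℂP^n, n_1, …, n_r)`: the quotient of
`ℂP^n × S^{n_1} × ⋯ × S^{n_r}` by `(y, x_1, …, x_r) ∼ (τ(y), −x_1, …, −x_r)`,
where `τ` is complex conjugation. -/
def CPGPP (n r : ℕ) (m : Fin r → ℕ) : Type _ :=
  Quot (fun a b : CP n × (∀ i : Fin r, Sph (m i)) =>
    b = (cpConj n a.1, fun i => negSph (m i) (a.2 i)))

noncomputable instance (n r : ℕ) (m : Fin r → ℕ) : TopologicalSpace (CPGPP n r m) := by
  unfold CPGPP; infer_instance

section Cochains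

variable {Q : Type*}

/-- The coboundary of a mod 2 cochain on ordered tuples of points. -/
def cob : (List Q → ZMod 2) → List Q → ZMod 2
  | _, [] => 0
  | Φ, v :: l => Φ l + cob (fun l' => Φ (v :: l')) l

/-- The dual prism operator of the pair of maps `α`, `β`. -/
def prism (α β : Q → Q) : (List Q → ZMod 2) → List Q → ZMod 2
  | _, [] => 0
  | Φ, v :: l => Φ (α v :: β v :: l.map β) + prism α β (fun l' => Φ (α v :: l')) l

lemma cob_add (Φ Ψ : List Q → ZMod 2) (l : List Q) : cob (Φ + Ψ) l = cob Φ l + cob Ψ l := by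
  induction l generalizing Φ Ψ with
  | nil => simp [cob]
  | cons v l ih =>
    have h := ih (fun l' => Φ (v :: l')) (fun l' => Ψ (v :: l'))
    simp only [cob]
    rw [show (fun l' => (Φ + Ψ) (v :: l')) =
      (fun l' => Φ (v :: l')) + (fun l' => Ψ (v :: l')) from rfl, h, Pi.add_apply]
    ring

lemma cob_zero (l : List Q) : cob (0 : List Q → ZMod 2) l = 0 := by
  have h := cob_add (0 : List Q → ZMod 2) 0 l
  simpa using h

lemma cob_sum {ι : Type*} (s : Finset ι) (Φ : ι → List Q → ZMod 2) (l : List Q) :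
    cob (∑ i ∈ s, Φ i) l = ∑ i ∈ s, cob (Φ i) l := by
  classical
  induction s using Finset.induction_on with
  | empty => simpa using cob_zero l
  | insert a s ha ih => rw [Finset.sum_insert ha, Finset.sum_insert ha, cob_add, ih]

lemma cob_const_mul (c : ZMod 2) (Φ : List Q → ZMod 2) (l : List Q) :
    cob (fun l' => c * Φ l') l = c * cob Φ l := by
  induction l generalizing Φ with
  | nil => simp [cob]
  | cons v l ih => simp only [cob, ih, mul_add]

lemma cob_map (β : Q → Q) (Φ : List Q → ZMod 2) (l : List Q) :
    cob (fun l' => Φ (l'.map β)) l = cob Φ (l.map β) := by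
  induction l generalizing Φ with
  | nil => simp [cob]
  | cons v l ih =>
    simp only [cob, List.map_cons]
    rw [ih (fun l' => Φ (β v :: l'))]

lemma cob_cob (Φ : List Q → ZMod 2) (l : List Q) : cob (cob Φ) l = 0 := by
  induction l generalizing Φ with
  | nil => simp [cob]
  | cons v l ih =>
    have h : (fun l' => cob Φ (v :: l')) = Φ + cob (fun l' => Φ (v :: l')) := rfl
    change cob Φ l + cob (fun l' => cob Φ (v :: l')) l = 0
    rw [h, cob_add, ih, add_zero, CharTwo.add_self_eq_zero]

lemma prism_add (α β : Q → Q) (Φ Ψ : List Q → ZMod 2) (l : List Q) :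
    prism α β (Φ + Ψ) l = prism α β Φ l + prism α β Ψ l := by
  induction l generalizing Φ Ψ with
  | nil => simp [prism]
  | cons v l ih =>
    have h := ih (fun l' => Φ (α v :: l')) (fun l' => Ψ (α v :: l'))
    simp only [prism]
    rw [show (fun l' => (Φ + Ψ) (α v :: l')) =
      (fun l' => Φ (α v :: l')) + (fun l' => Ψ (α v :: l')) from rfl, h, Pi.add_apply]
    ring

/-- The prism operator is a chain homotopy between `α` and `β`. -/
lemma prism_cob (α β : Q → Q) (Φ : List Q → ZMod 2) (l : List Q) :
    prism α β (cob Φ) l =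
      cob (prism α β Φ) l + (Φ (l.map α) + Φ (l.map β)) := by
  induction l generalizing Φ with
  | nil => simp [prism, cob, CharTwo.add_self_eq_zero]
  | cons v l ih =>
    have h1 : (fun l' => cob Φ (α v :: l')) = Φ + cob (fun l' => Φ (α v :: l')) := rfl
    have h2 : (fun l' => prism α β Φ (v :: l')) =
      (fun l' => Φ (α v :: β v :: l'.map β)) + prism α β (fun l' => Φ (α v :: l')) := rfl
    change cob Φ (α v :: β v :: l.map β) + prism α β (fun l' => cob Φ (α v :: l')) l =
      prism α β Φ l + cob (fun l' => prism α β Φ (v :: l')) l +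
        (Φ (α v :: l.map α) + Φ (β v :: l.map β))
    rw [h1, h2, cob, cob, prism_add, cob_add, ih (fun l' => Φ (α v :: l')),
      cob_map β (fun l' => Φ (α v :: β v :: l'))]
    have h3 := CharTwo.add_self_eq_zero (Φ (α v :: l.map β))
    linear_combination h3

lemma prism_congr (α β : Q → Q) {Φ Ψ : List Q → ZMod 2} {l : List Q}
    (h : ∀ l' : List Q, (∀ w ∈ l', ∃ u ∈ l, w = α u ∨ w = β u) → Φ l' = Ψ l') :
    prism α β Φ l = prism α β Ψ l := by
  induction l generalizing Φ Ψ with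
  | nil => simp [prism]
  | cons v l ih =>
    simp only [prism]
    congr 1
    · apply h
      intro w hw
      simp only [List.mem_cons, List.mem_map] at hw
      rcases hw with rfl | rfl | ⟨u, hu, rfl⟩
      · exact ⟨v, by simp, Or.inl rfl⟩
      · exact ⟨v, by simp, Or.inr rfl⟩
      · exact ⟨u, by simp [hu], Or.inr rfl⟩
    · apply ih
      intro l' hl'
      apply h
      intro w hw
      rcases List.mem_cons.1 hw with rfl | hw
      · exact ⟨v, by simp, Or.inl rfl⟩
      · obtain ⟨u, hu, h'⟩ := hl' w hw
        exact ⟨u, by simp [hu], h'⟩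

lemma prism_congr_maps {α β α' β' : Q → Q} (Φ : List Q → ZMod 2) {l : List Q}
    (h : ∀ u ∈ l, α u = α' u ∧ β u = β' u) : prism α β Φ l = prism α' β' Φ l := by
  induction l generalizing Φ with
  | nil => simp [prism]
  | cons v l ih =>
    simp only [prism]
    rw [ih _ (fun u hu => h u (by simp [hu])), (h v (by simp)).1, (h v (by simp)).2,
      List.map_congr_left (fun u hu => (h u (by simp [hu])).2)]

lemma prism_comp_left (α β c : Q → Q) (Φ : List Q → ZMod 2) (l : List Q) :
    prism α β (fun l' => Φ (l'.map c)) l = prism (c ∘ α) (c ∘ β) Φ l := by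
  induction l generalizing Φ with
  | nil => simp [prism]
  | cons v l ih =>
    simp only [prism, List.map_cons, Function.comp_apply, List.map_map]
    rw [ih (fun l' => Φ (c (α v) :: l'))]

lemma prism_comp_right (α β c : Q → Q) (Φ : List Q → ZMod 2) (l : List Q) :
    prism (α ∘ c) (β ∘ c) Φ l = prism α β Φ (l.map c) := by
  induction l generalizing Φ with
  | nil => simp [prism]
  | cons v l ih =>
    simp only [prism, List.map_cons, Function.comp_apply, List.map_map]
    rw [ih]

/-- Cochains vanishing on tuples with two equal adjacent entries. -/
def Normalized (Φ : List Q → ZMod 2) : Prop :=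
  ∀ l₁ v l₂, Φ (l₁ ++ v :: v :: l₂) = 0

lemma Normalized.cons {Φ : List Q → ZMod 2} (h : Normalized Φ) (u : Q) :
    Normalized (fun l' => Φ (u :: l')) := fun l₁ v l₂ => h (u :: l₁) v l₂

lemma prism_zero (α β : Q → Q) (l : List Q) : prism α β (fun _ => 0) l = 0 := by
  induction l with
  | nil => simp [prism]
  | cons v l ih => simp [prism, ih]

lemma Normalized.prism {Φ : List Q → ZMod 2} (h : Normalized Φ) (α β : Q → Q) :
    Normalized (prism α β Φ) := by
  intro l₁ v l₂
  induction l₁ generalizing Φ with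
  | nil =>
    have h0 : (fun l' => Φ (α v :: α v :: l')) = fun _ => 0 := by
      funext l'; exact h [] _ _
    have h1 : Φ (α v :: β v :: β v :: l₂.map β) = 0 := h [α v] _ _
    have h2 : Φ (α v :: α v :: β v :: l₂.map β) = 0 := h [] _ _
    simp [Paper.prism, h0, h1, h2, prism_zero]
  | cons u l₁ ih =>
    have h1 : Φ (α u :: β u :: (l₁ ++ v :: v :: l₂).map β) = 0 := by
      have := h (α u :: β u :: l₁.map β) (β v) (l₂.map β)
      simpa using this
    simp only [List.cons_append, Paper.prism, h1, zero_add]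
    exact ih (h.cons _)

lemma Normalized.prism_eq_zero {Φ : List Q → ZMod 2} (h : Normalized Φ) {α β : Q → Q}
    {l : List Q} (hl : ∀ u ∈ l, α u = β u) : Paper.prism α β Φ l = 0 := by
  induction l generalizing Φ with
  | nil => simp [Paper.prism]
  | cons v l ih =>
    have h1 := h [] (β v) (l.map β)
    simp only [List.nil_append] at h1
    rw [Paper.prism, ih (h.cons _) (fun u hu => hl u (by simp [hu])), hl v (by simp), h1, add_zero]

/-- Sum of prism operators along a zigzag subdivision of a homotopy `R`. -/
def step (R : ℕ → Q → Q) (N : ℕ) (Φ : List Q → ZMod 2) (l : List Q) : ZMod 2 :=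
  ∑ i ∈ Finset.range N, (prism (R (2 * i)) (R (2 * i + 1)) Φ l +
    prism (R (2 * i + 2)) (R (2 * i + 1)) Φ l)

lemma step_nil (R : ℕ → Q → Q) (N : ℕ) (Φ : List Q → ZMod 2) : step R N Φ [] = 0 := by
  simp [step, prism]

lemma step_add (R : ℕ → Q → Q) (N : ℕ) (Φ Ψ : List Q → ZMod 2) :
    step R N (Φ + Ψ) = step R N Φ + step R N Ψ := by
  funext l
  simp only [step, prism_add, Pi.add_apply, ← Finset.sum_add_distrib]
  exact Finset.sum_congr rfl fun i _ => by ring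

lemma sum_zigzag (f : ℕ → ZMod 2) (N : ℕ) :
    ∑ i ∈ Finset.range N, (f (2 * i) + f (2 * i + 2)) = f 0 + f (2 * N) := by
  induction N with
  | zero => simp [CharTwo.add_self_eq_zero]
  | succ n ih =>
    rw [Finset.sum_range_succ, ih]
    have := CharTwo.add_self_eq_zero (f (2 * n))
    rw [show 2 * (n + 1) = 2 * n + 2 by ring]
    linear_combination this

lemma step_cob (R : ℕ → Q → Q) (N : ℕ) (Φ : List Q → ZMod 2) :
    step R N (cob Φ) = cob (step R N Φ) +
      ((fun l => Φ (l.map (R 0))) + fun l => Φ (l.map (R (2 * N)))) := by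
  funext l
  have h1 : step R N Φ = ∑ i ∈ Finset.range N, (prism (R (2 * i)) (R (2 * i + 1)) Φ +
    prism (R (2 * i + 2)) (R (2 * i + 1)) Φ) := by
    funext l; simp [step]
  rw [h1, Pi.add_apply, cob_sum, step, Pi.add_apply,
    ← sum_zigzag (fun j => Φ (l.map (R j))), ← Finset.sum_add_distrib]
  refine Finset.sum_congr rfl fun i _ => ?_
  rw [cob_add, prism_cob, prism_cob]
  have := CharTwo.add_self_eq_zero (Φ (l.map (R (2 * i + 1))))
  linear_combination this

lemma Normalized.step {Φ : List Q → ZMod 2} (h : Normalized Φ) (R : ℕ → Q → Q) (N : ℕ) :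
    Normalized (step R N Φ) := fun l₁ v l₂ =>
  Finset.sum_eq_zero fun i _ => by rw [h.prism, h.prism, add_zero]

lemma Normalized.step_eq_zero {Φ : List Q → ZMod 2} (h : Normalized Φ) {R : ℕ → Q → Q} {N : ℕ}
    {l : List Q} (hl : ∀ j, ∀ u ∈ l, R j u = u) : Paper.step R N Φ l = 0 :=
  Finset.sum_eq_zero fun i _ => by
    rw [h.prism_eq_zero (fun u hu => by rw [hl _ u hu, hl _ u hu]),
      h.prism_eq_zero (fun u hu => by rw [hl _ u hu, hl _ u hu]), add_zero]

lemma step_congr {R : ℕ → Q → Q} {N : ℕ} {Φ Ψ : List Q → ZMod 2} {l : List Q}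
    (h : ∀ l' : List Q, ∀ j, (∀ w ∈ l', ∃ u ∈ l, w = R j u ∨ w = R (j + 1) u) → Φ l' = Ψ l') :
    step R N Φ l = step R N Ψ l :=
  Finset.sum_congr rfl fun i _ => by
    rw [prism_congr _ _ fun l' hl' => h l' (2 * i) hl',
      prism_congr _ _ fun l' hl' => h l' (2 * i + 1) fun w hw => by
        obtain ⟨u, hu, h'⟩ := hl' w hw
        exact ⟨u, hu, h'.symm⟩]

lemma step_comp_of_comm {R : ℕ → Q → Q} {N : ℕ} {Φ : List Q → ZMod 2} {l : List Q} {c c' : Q → Q}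
    (h : ∀ j, ∀ u ∈ l, c (R j u) = R j (c' u)) :
    step R N (fun l' => Φ (l'.map c)) l = step R N Φ (l.map c') :=
  Finset.sum_congr rfl fun i _ => by
    rw [prism_comp_left, prism_comp_left, ← prism_comp_right, ← prism_comp_right]
    congr 1 <;> exact prism_congr_maps Φ fun u hu => ⟨h _ u hu, h _ u hu⟩

lemma step_comp_of_reverse {R : ℕ → Q → Q} {N : ℕ} {Φ : List Q → ZMod 2} {l : List Q}
    {c c' : Q → Q} (h : ∀ j ≤ 2 * N, ∀ u ∈ l, c (R j u) = R (2 * N - j) (c' u)) :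
    step R N (fun l' => Φ (l'.map c)) l = step R N Φ (l.map c') := by
  unfold step
  rw [← Finset.sum_range_reflect]
  refine Finset.sum_congr rfl fun i hi => ?_
  have hi := Finset.mem_range.1 hi
  rw [prism_comp_left, prism_comp_left, ← prism_comp_right, ← prism_comp_right, add_comm]
  congr 1
  · apply prism_congr_maps
    intro u hu
    refine ⟨(h _ (by omega) u hu).trans ?_, (h _ (by omega) u hu).trans ?_⟩ <;>
    · rw [Function.comp_apply]; congr 1; omega
  · apply prism_congr_maps
    intro u hu
    refine ⟨(h _ (by omega) u hu).trans ?_, (h _ (by omega) u hu).trans ?_⟩ <;>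
    · rw [Function.comp_apply]; congr 1; omega

/-- The cup product of the coboundaries of the functions in the list. -/
def cup : List (Q → ZMod 2) → List Q → ZMod 2
  | [], [_] => 1
  | s :: S, v :: w :: l => (s v + s w) * cup S (w :: l)
  | _, _ => 0

lemma cup_nil_right (S : List (Q → ZMod 2)) : cup S [] = 0 := by
  cases S <;> simp [cup]

lemma cup_cons_singleton (s : Q → ZMod 2) (S : List (Q → ZMod 2)) (v : Q) :
    cup (s :: S) [v] = 0 := by simp [cup]

/-- The product of the function `s` with the cup product `cup S`. -/
def wcup (s : Q → ZMod 2) (S : List (Q → ZMod 2)) : List Q → ZMod 2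
  | [] => 0
  | v :: l => s v * cup S (v :: l)

lemma cob_cup_nil (l : List Q) : cob (cup ([] : List (Q → ZMod 2))) l = 0 := by
  have h2 : ∀ (a b : Q) (l : List Q), cob (fun l' => cup [] (a :: b :: l')) l = 0 := by
    intro a b l
    have : (fun l' => cup [] (a :: b :: l')) = (0 : List Q → ZMod 2) := by
      funext l'; simp [cup]
    rw [this, cob_zero]
  match l with
  | [] => simp [cob]
  | [v] => simp [cob, cup]
  | [v, w] => simp [cob, cup, CharTwo.add_self_eq_zero]
  | v :: w :: u :: l =>
    have h1 : cob (fun l' => cup [] (v :: l')) (w :: u :: l) = 0 := by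
      have h0 : cob (fun _ => 0) l = 0 := cob_zero l
      simp [cob, cup, h0]
    rw [cob, h1]
    simp [cup]

lemma cob_wcup_of_cob_cup (s : Q → ZMod 2) (S : List (Q → ZMod 2))
    (h : ∀ l, cob (cup S) l = 0) (l : List Q) : cob (wcup s S) l = cup (s :: S) l := by
  match l with
  | [] => simp [cob, cup_nil_right]
  | [v] => simp [cob, cup_cons_singleton, wcup]
  | v :: w :: l =>
    have h1 := h (v :: w :: l)
    rw [cob] at h1
    have h2 : (fun l' => wcup s S (v :: l')) = fun l' => s v * cup S (v :: l') := rfl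
    rw [cob, h2, cob_const_mul, wcup, cup]
    have h3 := CharTwo.add_self_eq_zero (s v * cup S (w :: l))
    linear_combination s v * h1 - h3

lemma cob_cup (S : List (Q → ZMod 2)) (l : List Q) : cob (cup S) l = 0 := by
  induction S generalizing l with
  | nil => exact cob_cup_nil l
  | cons s S ih =>
    rw [← funext (cob_wcup_of_cob_cup s S ih), cob_cob]

lemma cob_wcup (s : Q → ZMod 2) (S : List (Q → ZMod 2)) : cob (wcup s S) = cup (s :: S) :=
  funext (cob_wcup_of_cob_cup s S (cob_cup S))

lemma normalized_cup (S : List (Q → ZMod 2)) : Normalized (cup S) := by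
  intro l₁
  induction l₁ generalizing S with
  | nil => intro v l₂; cases S <;> simp [cup, CharTwo.add_self_eq_zero]
  | cons u l₁ ih =>
    intro v l₂
    cases S with
    | nil => cases l₁ <;> simp [cup]
    | cons s S =>
      cases l₁ with
      | nil =>
        have h := ih S v l₂
        simp only [List.nil_append] at h
        simp only [List.nil_append, List.cons_append, cup, h, mul_zero]
      | cons w l₁ =>
        have h := ih S v l₂
        simp only [List.cons_append] at h
        simp only [List.cons_append, cup, h, mul_zero]

lemma normalized_wcup (s : Q → ZMod 2) (S : List (Q → ZMod 2)) : Normalized (wcup s S) := by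
  intro l₁ v l₂
  have h := normalized_cup S l₁ v l₂
  cases l₁ <;> simp_all [wcup]

lemma cup_map {g : Q → Q} (S : List (Q → ZMod 2)) {l : List Q}
    (h : ∀ s ∈ S, ∃ χ, ∀ v ∈ l, s (g v) = s v + χ) : cup S (l.map g) = cup S l := by
  induction S generalizing l with
  | nil => match l with
    | [] => rfl
    | [v] => rfl
    | v :: w :: l => rfl
  | cons s S ih =>
    match l with
    | [] => rfl
    | [v] => rfl
    | v :: w :: l =>
      obtain ⟨χ, hχ⟩ := h s (by simp)
      have := ih (l := w :: l) (fun t ht => by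
        obtain ⟨χ, hχ⟩ := h t (by simp [ht])
        exact ⟨χ, fun v hv => hχ v (by simp [List.mem_cons.1 hv])⟩)
      simp only [List.map_cons] at this
      simp only [List.map_cons, cup, this, hχ v (by simp), hχ w (by simp)]
      have := CharTwo.add_self_eq_zero χ
      linear_combination cup S (w :: l) * this

lemma wcup_map {g : Q → Q} {s : Q → ZMod 2} (S : List (Q → ZMod 2)) {χ : ZMod 2} {l : List Q}
    (hs : ∀ v ∈ l, s (g v) = s v + χ) (h : ∀ s ∈ S, ∃ χ, ∀ v ∈ l, s (g v) = s v + χ) :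
    wcup s S (l.map g) = wcup s S l + χ * cup S l := by
  cases l with
  | nil => simp [wcup, cup_nil_right]
  | cons v l =>
    have := cup_map S h
    simp only [List.map_cons] at this
    simp only [List.map_cons, wcup, this, hs v (by simp)]
    ring

lemma cup_eq_zero_of_const {S : List (Q → ZMod 2)} {s : Q → ZMod 2} (hs : s ∈ S) {l : List Q}
    (h : ∀ v ∈ l, ∀ w ∈ l, s v = s w) : cup S l = 0 := by
  induction S generalizing l with
  | nil => simp at hs
  | cons t S ih =>
    match l with
    | [] => rfl
    | [v] => rfl
    | v :: w :: l =>
      rw [cup]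
      rcases List.mem_cons.1 hs with rfl | hs
      · rw [h v (by simp) w (by simp), CharTwo.add_self_eq_zero, zero_mul]
      · rw [ih hs (fun a ha b hb => h a (by simp [ha]) b (by simp [hb])), mul_zero]

end Cochains

section Tower

/-- A sequence of discretised half rotations sweeping out larger and larger subsets of `Q`. -/
structure RotTower (Q : Type*) [PseudoMetricSpace Q] (N n : ℕ) (δ : ℝ) where
  pt : Q
  supp : ℕ → Set Q
  rot : ℕ → ℕ → Q → Q
  sym : ℕ → Set (Q → Q)
  pt_mem : pt ∈ supp 0
  rot_mem : ∀ k < n, ∀ j, ∀ u ∈ supp k, rot k j u ∈ supp (k + 1)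
  dist_rot : ∀ k < n, ∀ j, ∀ u ∈ supp k, ∀ v ∈ supp k, dist (rot k j u) (rot k j v) ≤ dist u v
  dist_rot_succ : ∀ k < n, ∀ j, ∀ u ∈ supp k, dist (rot k j u) (rot k (j + 1) u) ≤ δ
  rot_zero : ∀ k < n, ∀ u ∈ supp k, rot k 0 u = u
  sym_pt : ∀ c ∈ sym 0, c pt = pt
  sym_rot : ∀ k < n, ∀ c ∈ sym (k + 1), ∃ c' ∈ sym k,
    (∀ j, ∀ u ∈ supp k, c (rot k j u) = rot k j (c' u)) ∨
    (∀ j ≤ 2 * N, ∀ u ∈ supp k, c (rot k j u) = rot k (2 * N - j) (c' u))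

variable {Q : Type*} [PseudoMetricSpace Q] {N n : ℕ} {δ : ℝ}

/-- Evaluation of a cochain on the fundamental chain of the `k`-th stage of the tower. -/
def RotTower.eval (T : RotTower Q N n δ) : ℕ → (List Q → ZMod 2) → ZMod 2
  | 0, Φ => Φ [T.pt]
  | k + 1, Φ => RotTower.eval T k (step (T.rot k) N Φ)

variable (T : RotTower Q N n δ)

lemma RotTower.eval_add (k : ℕ) (Φ Ψ : List Q → ZMod 2) :
    T.eval k (Φ + Ψ) = T.eval k Φ + T.eval k Ψ := by
  induction k generalizing Φ Ψ with
  | zero => rfl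
  | succ k ih => rw [eval, step_add, ih]; rfl

lemma RotTower.mesh_nonneg (T : RotTower Q N n δ) (k : ℕ) (hk : k < n) : 0 ≤ δ := by
  have h : ∀ i ≤ k, (T.supp i).Nonempty := by
    intro i
    induction i with
    | zero => exact fun _ => ⟨_, T.pt_mem⟩
    | succ i ih =>
      intro hi
      obtain ⟨u, hu⟩ := ih (by omega)
      exact ⟨_, T.rot_mem i (by omega) 0 u hu⟩
  obtain ⟨u, hu⟩ := h k le_rfl
  exact dist_nonneg.trans (T.dist_rot_succ k hk 0 u hu)

lemma RotTower.eval_congr_small {k : ℕ} (hk : k ≤ n) {Φ Ψ : List Q → ZMod 2}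
    (h : ∀ l : List Q, (∀ u ∈ l, u ∈ T.supp k) → (∀ u ∈ l, ∀ v ∈ l, dist u v ≤ k * δ) → Φ l = Ψ l) :
    T.eval k Φ = T.eval k Ψ := by
  induction k generalizing Φ Ψ with
  | zero => exact h _ (by simpa using T.pt_mem) (by simp)
  | succ k ih =>
    refine ih (by omega) fun l hl hd => step_congr fun l' j hl' => h l' ?_ ?_
    · intro w hw
      obtain ⟨u, hu, rfl | rfl⟩ := hl' w hw
      · exact T.rot_mem k hk _ u (hl u hu)
      · exact T.rot_mem k hk _ u (hl u hu)
    · have hδ := T.mesh_nonneg k hk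
      have key : ∀ i, ∀ u ∈ l, ∀ v ∈ l, dist (T.rot k i u) (T.rot k i v) ≤ k * δ := fun i u hu v hv =>
        (T.dist_rot k hk i u (hl u hu) v (hl v hv)).trans (hd u hu v hv)
      intro w hw w' hw'
      obtain ⟨u, hu, h1⟩ := hl' w hw
      obtain ⟨u', hu', h2⟩ := hl' w' hw'
      push_cast
      have k1 := key j u hu u' hu'
      have k2 := key (j + 1) u hu u' hu'
      have s1 := T.dist_rot_succ k hk j u (hl u hu)
      have s2 := T.dist_rot_succ k hk j u' (hl u' hu')
      rcases h1 with rfl | rfl <;> rcases h2 with rfl | rfl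
      · linarith
      · linarith [dist_triangle (T.rot k j u) (T.rot k j u') (T.rot k (j + 1) u')]
      · linarith [dist_triangle (T.rot k (j + 1) u) (T.rot k j u) (T.rot k j u'),
          dist_comm (T.rot k (j + 1) u) (T.rot k j u)]
      · linarith

lemma RotTower.eval_congr {k : ℕ} (hk : k ≤ n) {Φ Ψ : List Q → ZMod 2}
    (h : ∀ l : List Q, (∀ u ∈ l, u ∈ T.supp k) → Φ l = Ψ l) : T.eval k Φ = T.eval k Ψ :=
  T.eval_congr_small hk fun l hl _ => h l hl

lemma RotTower.eval_eq_zero {k : ℕ} (hk : k ≤ n) {Φ : List Q → ZMod 2}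
    (h : ∀ l : List Q, (∀ u ∈ l, u ∈ T.supp k) → Φ l = 0) : T.eval k Φ = 0 := by
  have h0 : ∀ k, T.eval k (0 : List Q → ZMod 2) = 0 := fun k => by
    have := T.eval_add k 0 0
    simpa using this
  rw [T.eval_congr hk (Ψ := 0) h, h0]

lemma RotTower.eval_sym {k : ℕ} (hk : k ≤ n) {c : Q → Q} (hc : c ∈ T.sym k)
    (Φ : List Q → ZMod 2) : T.eval k (fun l => Φ (l.map c)) = T.eval k Φ := by
  induction k generalizing Φ c with
  | zero => simp [eval, T.sym_pt c hc]
  | succ k ih =>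
    obtain ⟨c', hc', h⟩ := T.sym_rot k hk c hc
    rw [eval, eval, ← ih (by omega) hc' (step (T.rot k) N Φ)]
    refine T.eval_congr (by omega) fun l hl => ?_
    rcases h with h | h
    · exact step_comp_of_comm fun j u hu => h j u (hl u hu)
    · exact step_comp_of_reverse fun j hj u hu => h j hj u (hl u hu)

/-- The boundary formula along a range of stages `k₀ ≤ k < k₁` on a class `K k` of cochains. -/
lemma RotTower.eval_cob (k₀ k₁ : ℕ) (hk₁ : k₁ ≤ n) (K : ℕ → Set (List Q → ZMod 2))
    (hK : ∀ k, k₀ ≤ k → k < k₁ → ∀ Φ ∈ K (k + 1), step (T.rot k) N Φ ∈ K k)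
    (hbase : ∀ Φ ∈ K (k₀ + 1), Normalized Φ → T.eval k₀ (cob (step (T.rot k₀) N Φ)) = 0)
    (γ : Q → Q) (hγ : ∀ k, k₀ ≤ k → k < k₁ → ∀ u ∈ T.supp k, γ u ∈ T.supp k)
    (hdeg : ∀ k, k₀ ≤ k → k + 1 < k₁ → ∀ j, ∀ u ∈ T.supp k, T.rot (k + 1) j u = u)
    (hturn : ∀ k, k₀ ≤ k → k < k₁ → ∃ c ∈ T.sym k, ∀ u ∈ T.supp k, T.rot k (2 * N) u = γ (c u))
    (k : ℕ) (hk₀ : k₀ ≤ k) (hk : k < k₁) (Φ : List Q → ZMod 2) (hΦK : Φ ∈ K (k + 1))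
    (hΦ : Normalized Φ) :
    T.eval (k + 1) (cob Φ) = T.eval k Φ + T.eval k (fun l => Φ (l.map γ)) := by
  have main : ∀ k, k₀ ≤ k → k < k₁ → ∀ Φ ∈ K (k + 1), Normalized Φ →
      T.eval k (cob (step (T.rot k) N Φ)) = 0 →
      T.eval (k + 1) (cob Φ) = T.eval k Φ + T.eval k (fun l => Φ (l.map γ)) := by
    intro k hk₀ hk Φ hΦK hΦ h0
    obtain ⟨c, hc, hct⟩ := hturn k hk₀ hk
    rw [eval, step_cob, T.eval_add, h0, zero_add, T.eval_add]
    congr 1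
    · refine T.eval_congr (by omega) fun l hl => ?_
      have : l.map (T.rot k 0) = l.map id :=
        List.map_congr_left fun u hu => T.rot_zero k (by omega) u (hl u hu)
      simp only [this, List.map_id]
    · rw [← T.eval_sym (by omega) hc (fun l => Φ (l.map γ))]
      refine T.eval_congr (by omega) fun l hl => ?_
      simp only [List.map_map]
      congr 1
      exact List.map_congr_left fun u hu => hct u (hl u hu)
  have degen : ∀ k, k₀ ≤ k → k + 1 < k₁ → ∀ Φ ∈ K (k + 2), Normalized Φ →
      T.eval k (step (T.rot (k + 1)) N Φ) = 0 ∧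
        T.eval k (fun l => step (T.rot (k + 1)) N Φ (l.map γ)) = 0 := by
    intro k hk₀ hk Φ hΦK hΦ
    refine ⟨T.eval_eq_zero (k := k) (by omega) fun l hl => ?_,
      T.eval_eq_zero (k := k) (by omega) fun l hl => ?_⟩
    · exact hΦ.step_eq_zero fun j u hu => hdeg _ hk₀ hk j u (hl u hu)
    · refine hΦ.step_eq_zero fun j u hu => hdeg _ hk₀ hk j u ?_
      obtain ⟨w, hw, rfl⟩ := List.mem_map.1 hu
      exact hγ _ hk₀ (by omega) w (hl w hw)
  have vanish : ∀ k, k₀ ≤ k → k < k₁ → ∀ Φ ∈ K (k + 1), Normalized Φ →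
      T.eval k (cob (step (T.rot k) N Φ)) = 0 := by
    intro k hk₀
    induction k, hk₀ using Nat.le_induction with
    | base => exact fun _ => hbase
    | succ k hle ih =>
      intro hk Φ hΦK hΦ
      have hΨK := hK _ (by omega) hk _ hΦK
      have hΨ := hΦ.step (T.rot (k + 1)) N
      obtain ⟨d1, d2⟩ := degen k hle hk Φ hΦK hΦ
      rw [main k hle (by omega) _ hΨK hΨ (ih (by omega) _ hΨK hΨ), d1, d2, add_zero]
  exact main k hk₀ hk Φ hΦK hΦ (vanish k hk₀ hk Φ hΦK hΦ)

end Tower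

section Tilt

variable {d : ℕ}

/-- Rotation by `θ` in the coordinate plane `(k, k+1)`, for vectors with vanishing
coordinate `k+1`. -/
noncomputable def tilt (k : ℕ) (θ : ℝ) (v : Fin (d + 1) → ℝ) : Fin (d + 1) → ℝ := fun i =>
  if (i : ℕ) = k then Real.cos θ * v i
  else if h : (i : ℕ) = k + 1 then Real.sin θ * v ⟨k, by omega⟩ else v i

/-- Unit vectors whose coordinates of index larger than `k` vanish. -/
def flag (d k : ℕ) : Set (Fin (d + 1) → ℝ) := {v | ∑ i, v i ^ 2 = 1 ∧ ∀ i : Fin (d + 1), k < i → v i = 0}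

/-- Coordinatewise multiplication by the sequence `ε`. -/
def flip (ε : ℕ → ℝ) (v : Fin (d + 1) → ℝ) : Fin (d + 1) → ℝ := fun i => ε i * v i

lemma abs_le_one_of_mem_flag {k : ℕ} {v : Fin (d + 1) → ℝ} (hv : v ∈ flag d k)
    (i : Fin (d + 1)) : |v i| ≤ 1 := by
  rw [← sq_le_one_iff_abs_le_one, ← hv.1]
  exact Finset.single_le_sum (f := fun i => v i ^ 2) (fun i _ => sq_nonneg _) (Finset.mem_univ i)

lemma tilt_mem_flag {k : ℕ} (hk : k < d) (θ : ℝ) {v : Fin (d + 1) → ℝ} (hv : v ∈ flag d k) :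
    tilt k θ v ∈ flag d (k + 1) := by
  constructor
  · have h1 : v ⟨k + 1, by omega⟩ = 0 := hv.2 _ (by simp)
    have hne : (⟨k, by omega⟩ : Fin (d + 1)) ≠ ⟨k + 1, by omega⟩ := by simp
    have h : ∑ i, (tilt k θ v i ^ 2 - v i ^ 2) = 0 := by
      rw [Finset.sum_eq_add (⟨k, by omega⟩ : Fin (d + 1)) ⟨k + 1, by omega⟩ hne]
      · simp only [tilt, if_true, h1]
        simp only [Nat.succ_ne_self, if_false, dif_pos]
        linear_combination v ⟨k, by omega⟩ ^ 2 * Real.sin_sq_add_cos_sq θ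
      · rintro i - ⟨h2, h3⟩
        have h2 : (i : ℕ) ≠ k := fun h => h2 (Fin.ext h)
        have h3 : (i : ℕ) ≠ k + 1 := fun h => h3 (Fin.ext h)
        simp [tilt, h2, h3]
      · simp
      · simp
    rw [Finset.sum_sub_distrib, hv.1] at h
    linarith
  · intro i hi
    rw [tilt, if_neg (by omega), dif_neg (by omega)]
    exact hv.2 i (by omega)

lemma tilt_zero {k : ℕ} {v : Fin (d + 1) → ℝ} (hv : v ∈ flag d k) : tilt k 0 v = v := by
  funext i
  by_cases h1 : (i : ℕ) = k
  · simp [tilt, h1]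
  · by_cases h2 : (i : ℕ) = k + 1
    · simp [tilt, h2, hv.2 i (by omega)]
    · simp [tilt, h1, h2]

lemma tilt_succ_eq {k : ℕ} (θ : ℝ) {v : Fin (d + 1) → ℝ} (hv : v ∈ flag d k) :
    tilt (k + 1) θ v = v := by
  funext i
  by_cases h1 : (i : ℕ) = k + 1
  · simp [tilt, h1, hv.2 i (by omega)]
  · by_cases h2 : (i : ℕ) = k + 1 + 1
    · simp [tilt, h2, hv.2 i (by omega), hv.2 ⟨k + 1, by omega⟩ (by simp)]
    · simp [tilt, h1, h2]

lemma tilt_pi {k : ℕ} {v : Fin (d + 1) → ℝ} (hv : v ∈ flag d k) :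
    tilt k Real.pi v = flip (fun i => if i = k then -1 else 1) v := by
  funext i
  by_cases h1 : (i : ℕ) = k
  · simp [tilt, flip, h1]
  · by_cases h2 : (i : ℕ) = k + 1
    · simp [tilt, flip, h2, hv.2 i (by omega)]
    · simp [tilt, flip, h1, h2]

lemma flip_tilt_comm {ε : ℕ → ℝ} {k : ℕ} (h1 : ε (k + 1) = 1) (h0 : ε k = 1) (θ : ℝ)
    (v : Fin (d + 1) → ℝ) : flip ε (tilt k θ v) = tilt k θ (flip ε v) := by
  funext i
  by_cases h2 : (i : ℕ) = k
  · simp [tilt, flip, h2]; ring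
  · by_cases h3 : (i : ℕ) = k + 1
    · simp [tilt, flip, h3, h1, h0]
    · simp [tilt, flip, h2, h3]

lemma flip_tilt_reverse {ε : ℕ → ℝ} {k : ℕ} (h1 : ε (k + 1) = 1) (h0 : ε k = -1) (θ : ℝ)
    (v : Fin (d + 1) → ℝ) :
    flip ε (tilt k θ v) = tilt k (Real.pi - θ) (flip (Function.update ε k 1) v) := by
  funext i
  by_cases h2 : (i : ℕ) = k
  · simp [tilt, flip, h2, h0]
  · by_cases h3 : (i : ℕ) = k + 1
    · simp [tilt, flip, h3, h1]
    · simp [tilt, flip, h2, h3]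

lemma dist_tilt_le (k : ℕ) (θ : ℝ) (v w : Fin (d + 1) → ℝ) :
    dist (tilt k θ v) (tilt k θ w) ≤ dist v w := by
  have key : ∀ c : ℝ, |c| ≤ 1 → ∀ i, dist (c * v i) (c * w i) ≤ dist v w := by
    intro c hc i
    refine le_trans ?_ (dist_le_pi_dist v w i)
    rw [Real.dist_eq, Real.dist_eq, ← mul_sub, abs_mul]
    exact mul_le_of_le_one_left (abs_nonneg _) hc
  refine (dist_pi_le_iff dist_nonneg).2 fun i => ?_
  simp only [tilt]
  split_ifs with h1 h2
  · exact key _ (Real.abs_cos_le_one θ) i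
  · exact key _ (Real.abs_sin_le_one θ) _
  · exact dist_le_pi_dist v w i

lemma dist_tilt_tilt_le (k : ℕ) (θ θ' : ℝ) {v : Fin (d + 1) → ℝ} (hv : v ∈ flag d k) :
    dist (tilt k θ v) (tilt k θ' v) ≤ |θ - θ'| := by
  refine (dist_pi_le_iff (abs_nonneg _)).2 fun i => ?_
  have h := abs_le_one_of_mem_flag hv
  simp only [tilt]
  split_ifs with h1 h2
  · rw [Real.dist_eq, ← sub_mul, abs_mul]
    exact (mul_le_of_le_one_right (abs_nonneg _) (h _)).trans (Real.abs_cos_sub_cos_le _ _)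
  · rw [Real.dist_eq, ← sub_mul, abs_mul]
    exact (mul_le_of_le_one_right (abs_nonneg _) (h _)).trans (Real.abs_sin_sub_sin_le _ _)
  · simp

/-- Sequences of signs. -/
def IsSign (ε : ℕ → ℝ) : Prop := ∀ i, ε i = 1 ∨ ε i = -1

lemma flip_mem_flag {ε : ℕ → ℝ} (hε : IsSign ε) {k : ℕ} {v : Fin (d + 1) → ℝ}
    (hv : v ∈ flag d k) : flip ε v ∈ flag d k := by
  constructor
  · rw [← hv.1]
    refine Finset.sum_congr rfl fun i _ => ?_
    rcases hε i with h | h <;> simp [flip, h]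
  · intro i hi
    simp [flip, hv.2 i hi]

lemma neg_mem_flag {k : ℕ} {v : Fin (d + 1) → ℝ} (hv : v ∈ flag d k) : -v ∈ flag d k :=
  ⟨by simpa using hv.1, fun i hi => by simp [hv.2 i hi]⟩

end Tilt

section BorsukUlam

variable (a b N : ℕ)

/-- The tower exhausting the product of two spheres of dimensions `a` and `b`. -/
noncomputable def sphTower (hN : 0 < N) :
    RotTower ((Fin (a + 1) → ℝ) × (Fin (b + 1) → ℝ)) N (a + b) (Real.pi / (2 * N)) where
  pt := (Pi.single 0 1, Pi.single 0 1)
  supp k := flag a (min k a) ×ˢ flag b (k - a)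
  rot k j u := if k < a then (tilt k (Real.pi * j / (2 * N)) u.1, u.2)
    else (u.1, tilt (k - a) (Real.pi * j / (2 * N)) u.2)
  sym k := {c | ∃ ε δ : ℕ → ℝ, IsSign ε ∧ IsSign δ ∧ ε (min k a) = 1 ∧ δ (k - a) = 1 ∧
    c = Prod.map (flip ε) (flip δ)}
  pt_mem := by
    have h : ∀ d, (Pi.single 0 1 : Fin (d + 1) → ℝ) ∈ flag d 0 := fun d => by
      refine ⟨?_, fun i hi => ?_⟩
      · rw [Finset.sum_eq_single 0] <;> simp +contextual
      · exact Pi.single_eq_of_ne (by rintro rfl; simp at hi) _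
    simpa using ⟨h a, h b⟩
  rot_mem := by
    rintro k hk j ⟨v, x⟩ ⟨hv, hx⟩
    by_cases h : k < a
    · rw [if_pos h]
      simp only [Nat.min_eq_left h.le, Nat.sub_eq_zero_of_le h.le] at hv hx
      simp only [Nat.min_eq_left (Nat.succ_le_of_lt h), Nat.sub_eq_zero_of_le (Nat.succ_le_of_lt h)]
      exact ⟨tilt_mem_flag h _ hv, hx⟩
    · rw [if_neg h]
      have h' : a ≤ k := not_lt.1 h
      simp only [Nat.min_eq_right h'] at hv
      simp only [Nat.min_eq_right (h'.trans k.le_succ), Nat.succ_sub h']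
      exact ⟨hv, tilt_mem_flag (by omega) _ hx⟩
  dist_rot := by
    rintro k hk j ⟨v, x⟩ - ⟨v', x'⟩ -
    split_ifs
    · exact max_le_max (dist_tilt_le _ _ _ _) le_rfl
    · exact max_le_max le_rfl (dist_tilt_le _ _ _ _)
  dist_rot_succ := by
    rintro k hk j ⟨v, x⟩ ⟨hv, hx⟩
    have hθ : |Real.pi * j / (2 * N) - Real.pi * (j + 1 : ℕ) / (2 * N)| = Real.pi / (2 * N) := by
      rw [← abs_of_nonneg (show 0 ≤ Real.pi / (2 * N) by positivity), ← abs_neg]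
      congr 1
      push_cast
      ring
    by_cases h : k < a
    · simp only [Nat.min_eq_left h.le] at hv
      rw [if_pos h, if_pos h, Prod.dist_eq, dist_self, max_eq_left dist_nonneg, ← hθ]
      exact dist_tilt_tilt_le _ _ _ hv
    · rw [if_neg h, if_neg h, Prod.dist_eq, dist_self, max_eq_right dist_nonneg, ← hθ]
      exact dist_tilt_tilt_le _ _ _ hx
  rot_zero := by
    rintro k hk ⟨v, x⟩ ⟨hv, hx⟩
    by_cases h : k < a
    · simp only [Nat.min_eq_left h.le] at hv
      simp [if_pos h, tilt_zero hv]
    · simp [if_neg h, tilt_zero hx]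
  sym_pt := by
    rintro c ⟨ε, δ, -, -, hε, hδ, rfl⟩
    have h : ∀ d (ε : ℕ → ℝ), ε 0 = 1 → flip ε (Pi.single 0 1 : Fin (d + 1) → ℝ) = Pi.single 0 1 := by
      intro d ε h
      funext i
      rcases eq_or_ne i 0 with rfl | hi
      · simp [flip, h]
      · simp [flip, Pi.single_eq_of_ne hi]
    simp only [Nat.zero_min, Nat.zero_sub] at hε hδ
    simp [h _ _ hε, h _ _ hδ]
  sym_rot := by
    rintro k hk c ⟨ε, δ, hεs, hδs, hε, hδ, rfl⟩
    have hθ : ∀ j ≤ 2 * N, Real.pi - Real.pi * j / (2 * N) =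
        Real.pi * (2 * N - j : ℕ) / (2 * N) := by
      intro j hj
      push_cast [hj]
      field_simp
    have hu : ∀ ε : ℕ → ℝ, IsSign ε → ∀ k, IsSign (Function.update ε k 1) := by
      intro ε h k i
      rcases eq_or_ne i k with rfl | hi
      · simp
      · simpa [hi] using h i
    by_cases h : k < a
    · simp only [Nat.min_eq_left (Nat.succ_le_of_lt h),
        Nat.sub_eq_zero_of_le (Nat.succ_le_of_lt h)] at hε hδ
      simp only [Nat.min_eq_left h.le, Nat.sub_eq_zero_of_le h.le, if_pos h]
      rcases hεs k with h0 | h0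
      · refine ⟨_, ⟨ε, δ, hεs, hδs, h0, hδ, rfl⟩, Or.inl ?_⟩
        intro j u _
        exact Prod.ext (flip_tilt_comm hε h0 _ _) rfl
      · refine ⟨_, ⟨_, δ, hu ε hεs k, hδs, by simp, hδ, rfl⟩, Or.inr ?_⟩
        intro j hj u _
        rw [← hθ j hj]
        exact Prod.ext (flip_tilt_reverse hε h0 _ _) rfl
    · have h' : a ≤ k := not_lt.1 h
      simp only [Nat.min_eq_right (h'.trans k.le_succ), Nat.succ_sub h'] at hε hδ
      simp only [Nat.min_eq_right h', if_neg h]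
      rcases hδs (k - a) with h0 | h0
      · refine ⟨_, ⟨ε, δ, hεs, hδs, hε, h0, rfl⟩, Or.inl ?_⟩
        intro j u _
        exact Prod.ext rfl (flip_tilt_comm hδ h0 _ _)
      · refine ⟨_, ⟨ε, _, hεs, hu δ hδs (k - a), hε, by simp, rfl⟩, Or.inr ?_⟩
        intro j hj u _
        rw [← hθ j hj]
        exact Prod.ext rfl (flip_tilt_reverse hδ h0 _ _)

variable {a b N}

/-- The product of the unit spheres in `ℝ^{a+1}` and `ℝ^{b+1}`. -/
def sphProd (a b : ℕ) : Set ((Fin (a + 1) → ℝ) × (Fin (b + 1) → ℝ)) :=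
  {u | ∑ i, u.1 i ^ 2 = 1 ∧ ∑ i, u.2 i ^ 2 = 1}

/-- The antipodal map of the first sphere. -/
def negFst (u : (Fin (a + 1) → ℝ) × (Fin (b + 1) → ℝ)) :
    (Fin (a + 1) → ℝ) × (Fin (b + 1) → ℝ) := (-u.1, u.2)

/-- The product of a coordinate reflection with the antipodal map of the second sphere. -/
def flipNeg (ε : ℕ → ℝ) (u : (Fin (a + 1) → ℝ) × (Fin (b + 1) → ℝ)) :
    (Fin (a + 1) → ℝ) × (Fin (b + 1) → ℝ) := (flip ε u.1, -u.2)

lemma supp_subset_sphProd (hN : 0 < N) {k : ℕ} {u : (Fin (a + 1) → ℝ) × (Fin (b + 1) → ℝ)}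
    (hu : u ∈ (sphTower a b N hN).supp k) : u ∈ sphProd a b := ⟨hu.1.1, hu.2.1⟩

lemma isSign_one : IsSign fun _ => 1 := fun _ => Or.inl rfl

lemma isSign_except (k : ℕ) : IsSign fun i => if i = k then 1 else -1 := fun i => by
  by_cases h : i = k <;> simp [h]

lemma flip_one {d : ℕ} (v : Fin (d + 1) → ℝ) : flip (fun _ => 1) v = v := by
  funext i; simp [flip]

lemma flip_neg_except {d : ℕ} (k : ℕ) (v : Fin (d + 1) → ℝ) :
    flip (fun i => if i = k then -1 else 1) v = -flip (fun i => if i = k then 1 else -1) v := by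
  funext i
  by_cases h : (i : ℕ) = k <;> simp [flip, h]

lemma flip_flip {d : ℕ} {ε : ℕ → ℝ} (hε : IsSign ε) (v : Fin (d + 1) → ℝ) :
    flip ε (flip ε v) = v := by
  funext i
  rcases hε i with h | h <;> simp [flip, h]

lemma flip_neg' {d : ℕ} (ε : ℕ → ℝ) (v : Fin (d + 1) → ℝ) : flip ε (-v) = -flip ε v := by
  funext i; simp [flip]

lemma turn_angle (hN : 0 < N) : Real.pi * (2 * N : ℕ) / (2 * N) = Real.pi := by
  have : (N : ℝ) ≠ 0 := by positivity
  push_cast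
  field_simp

lemma negFst_mem_supp (hN : 0 < N) (k : ℕ) (u) (hu : u ∈ (sphTower a b N hN).supp k) :
    negFst u ∈ (sphTower a b N hN).supp k := ⟨neg_mem_flag hu.1, hu.2⟩

lemma flipNeg_mem_supp (hN : 0 < N) {ε : ℕ → ℝ} (hε : IsSign ε) (k : ℕ) (u)
    (hu : u ∈ (sphTower a b N hN).supp k) : flipNeg ε u ∈ (sphTower a b N hN).supp k :=
  ⟨flip_mem_flag hε hu.1, neg_mem_flag hu.2⟩

lemma eval_cob_fst (hN : 0 < N) {k : ℕ} (hk : k < a)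
    {Φ : List ((Fin (a + 1) → ℝ) × (Fin (b + 1) → ℝ)) → ZMod 2} (hΦ : Normalized Φ) :
    (sphTower a b N hN).eval (k + 1) (cob Φ) =
      (sphTower a b N hN).eval k Φ + (sphTower a b N hN).eval k fun l => Φ (l.map negFst) := by
  refine (sphTower a b N hN).eval_cob 0 a (by omega) (fun _ => univ) (fun _ _ _ _ _ => trivial) ?_
    negFst (fun k _ _ u hu => negFst_mem_supp hN k u hu) ?_ ?_ k (Nat.zero_le _) hk Φ trivial hΦ
  · intro Φ _ _
    simp [RotTower.eval, cob, step_nil]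
  · rintro k - hk j ⟨v, x⟩ ⟨hv, -⟩
    simp only [Nat.min_eq_left (show k ≤ a by omega)] at hv
    simp [sphTower, hk, tilt_succ_eq _ hv]
  · rintro k - hk
    refine ⟨_, ⟨_, _, isSign_except k, isSign_one, by simp [hk.le], rfl, rfl⟩, ?_⟩
    rintro ⟨v, x⟩ ⟨hv, -⟩
    simp only [Nat.min_eq_left hk.le] at hv
    simp only [sphTower, hk, if_true, turn_angle hN, tilt_pi hv, Prod.map_apply, flip_one, negFst,
      flip_neg_except]

lemma eval_cob_snd (hN : 0 < N) {ε : ℕ → ℝ} (hε : IsSign ε) (hεa : ε a = 1) {k : ℕ} (hk : k < b)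
    {Φ : List ((Fin (a + 1) → ℝ) × (Fin (b + 1) → ℝ)) → ZMod 2} (hΦ : Normalized Φ)
    (hg : ∀ l, (∀ u ∈ l, u ∈ (sphTower a b N hN).supp (a + k + 1)) → Φ (l.map negFst) = Φ l) :
    (sphTower a b N hN).eval (a + k + 1) (cob Φ) =
      (sphTower a b N hN).eval (a + k) Φ +
        (sphTower a b N hN).eval (a + k) fun l => Φ (l.map (flipNeg ε)) := by
  have hK : ∀ k, a ≤ k → k < a + b → ∀ Φ : List ((Fin (a + 1) → ℝ) × (Fin (b + 1) → ℝ)) → ZMod 2,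
      (∀ l, (∀ u ∈ l, u ∈ (sphTower a b N hN).supp (k + 1)) → Φ (l.map negFst) = Φ l) →
      ∀ l, (∀ u ∈ l, u ∈ (sphTower a b N hN).supp k) →
        step ((sphTower a b N hN).rot k) N Φ (l.map negFst) =
          step ((sphTower a b N hN).rot k) N Φ l := by
    intro k hk hk' Φ hΦ l hl
    rw [← step_comp_of_comm (c := negFst)]
    · refine step_congr fun l' j hl' => hΦ l' fun w hw => ?_
      obtain ⟨u, hu, rfl | rfl⟩ := hl' w hw
      · exact (sphTower a b N hN).rot_mem k hk' _ u (hl u hu)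
      · exact (sphTower a b N hN).rot_mem k hk' _ u (hl u hu)
    · intro j u _
      simp [sphTower, not_lt.2 hk, negFst]
  refine (sphTower a b N hN).eval_cob a (a + b) le_rfl
    (fun k => {Φ | ∀ l, (∀ u ∈ l, u ∈ (sphTower a b N hN).supp k) → Φ (l.map negFst) = Φ l})
    hK ?_ (flipNeg ε) (fun k _ _ u hu => flipNeg_mem_supp hN hε k u hu) ?_ ?_ (a + k)
    (by omega) (by omega) Φ hg hΦ
  · intro Φ hg hΦ
    rcases Nat.eq_zero_or_pos a with rfl | ha
    · simp [RotTower.eval, cob, step_nil]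
    · obtain ⟨i, rfl⟩ : ∃ i, a = i + 1 := ⟨a - 1, by omega⟩
      rcases Nat.eq_zero_or_pos b with rfl | hb
      · omega
      rw [eval_cob_fst hN (Nat.lt_succ_self i) (hΦ.step _ _),
        ← (sphTower (i + 1) b N hN).eval_add]
      refine (sphTower (i + 1) b N hN).eval_eq_zero (by omega) fun l hl => ?_
      rw [Pi.add_apply, hK (i + 1) le_rfl (by omega) Φ hg, CharTwo.add_self_eq_zero]
      rintro ⟨v, x⟩ hu
      obtain ⟨hv, hx⟩ := hl _ hu
      simp only [Nat.min_eq_left (Nat.le_succ i), Nat.sub_eq_zero_of_le (Nat.le_succ i)] at hv hx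
      simpa [sphTower] using ⟨⟨hv.1, fun i hi => absurd i.2 (by omega)⟩, hx⟩
  · rintro k hak hk j ⟨v, x⟩ ⟨-, hx⟩
    simp [sphTower, not_lt.2 (hak.trans k.le_succ), Nat.succ_sub hak, tilt_succ_eq _ hx]
  · rintro k hak hk
    refine ⟨_, ⟨_, _, hε, isSign_except (k - a), by simp [hak, hεa], by simp, rfl⟩, ?_⟩
    rintro ⟨v, x⟩ ⟨-, hx⟩
    simp only [sphTower, not_lt.2 hak, if_false, turn_angle hN, tilt_pi hx, Prod.map_apply,
      flipNeg, flip_flip hε, flip_neg_except]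

/-- The cup product of the coboundaries of suitably equivariant functions evaluates to `1` on the
fundamental chain of the product of two spheres. -/
theorem eval_cup_eq_one (hN : 0 < N) {ε : ℕ → ℝ} (hε : IsSign ε) (hεa : ε a = 1)
    (S T : List ((Fin (a + 1) → ℝ) × (Fin (b + 1) → ℝ) → ZMod 2))
    (hS : S.length = b) (hT : T.length = a)
    (hSg : ∀ s ∈ S, ∀ u ∈ sphProd a b, s (negFst u) = s u)
    (hSτ : ∀ s ∈ S, ∀ u ∈ sphProd a b, s (flipNeg ε u) = s u + 1)
    (hTg : ∀ s ∈ T, ∀ u ∈ sphProd a b, s (negFst u) = s u + 1)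
    (hTτ : ∀ s ∈ T, ∃ χ, ∀ u ∈ sphProd a b, s (flipNeg ε u) = s u + χ) :
    (sphTower a b N hN).eval (a + b) (cup (S ++ T)) = 1 := by
  have hfst : ∀ T : List ((Fin (a + 1) → ℝ) × (Fin (b + 1) → ℝ) → ZMod 2), T.length ≤ a →
      (∀ s ∈ T, ∀ u ∈ sphProd a b, s (negFst u) = s u + 1) →
      (sphTower a b N hN).eval T.length (cup T) = 1 := by
    intro T
    induction T with
    | nil => intro _ _; rfl
    | cons s T ih =>
      intro hT hTg
      simp only [List.length_cons] at hT ⊢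
      rw [← cob_wcup, eval_cob_fst hN (by omega) (normalized_wcup s T),
        ← ih (by omega) fun t ht => hTg t (by simp [ht]), ← (sphTower a b N hN).eval_add]
      refine (sphTower a b N hN).eval_congr (by omega) fun l hl => ?_
      rw [Pi.add_apply, wcup_map (χ := 1) T
        (fun v hv => hTg s (by simp) v (supp_subset_sphProd hN (hl v hv)))
        (fun t ht => ⟨1, fun v hv => hTg t (by simp [ht]) v (supp_subset_sphProd hN (hl v hv))⟩),
        one_mul, ← add_assoc, CharTwo.add_self_eq_zero, zero_add]
  have hsnd : ∀ S : List ((Fin (a + 1) → ℝ) × (Fin (b + 1) → ℝ) → ZMod 2), S.length ≤ b →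
      (∀ s ∈ S, ∀ u ∈ sphProd a b, s (negFst u) = s u) →
      (∀ s ∈ S, ∀ u ∈ sphProd a b, s (flipNeg ε u) = s u + 1) →
      (sphTower a b N hN).eval (a + S.length) (cup (S ++ T)) = 1 := by
    intro S
    induction S with
    | nil => intro _ _ _; simpa [hT] using hfst T hT.le hTg
    | cons s S ih =>
      intro hS hSg hSτ
      simp only [List.length_cons, List.cons_append, ← add_assoc] at hS ⊢
      have hg : ∀ t ∈ S ++ T, ∃ χ, ∀ u ∈ sphProd a b, t (negFst u) = t u + χ := by
        intro t ht
        rcases List.mem_append.1 ht with ht | ht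
        · exact ⟨0, fun u hu => by rw [hSg t (by simp [ht]) u hu, add_zero]⟩
        · exact ⟨1, hTg t ht⟩
      have hτ : ∀ t ∈ S ++ T, ∃ χ, ∀ u ∈ sphProd a b, t (flipNeg ε u) = t u + χ := by
        intro t ht
        rcases List.mem_append.1 ht with ht | ht
        · exact ⟨1, hSτ t (by simp [ht])⟩
        · exact hTτ t ht
      rw [← cob_wcup, eval_cob_snd hN hε hεa (by omega) (normalized_wcup s _),
        ← ih (by omega) (fun t ht => hSg t (by simp [ht])) fun t ht => hSτ t (by simp [ht]),
        ← (sphTower a b N hN).eval_add]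
      · refine (sphTower a b N hN).eval_congr (by omega) fun l hl => ?_
        rw [Pi.add_apply, wcup_map (χ := 1) (S ++ T)
          (fun v hv => hSτ s (by simp) v (supp_subset_sphProd hN (hl v hv)))
          (fun t ht => (hτ t ht).imp fun χ h v hv => h v (supp_subset_sphProd hN (hl v hv))),
          one_mul, ← add_assoc, CharTwo.add_self_eq_zero, zero_add]
      · intro l hl
        rw [wcup_map (χ := 0) (S ++ T)
          (fun v hv => by rw [hSg s (by simp) v (supp_subset_sphProd hN (hl v hv)), add_zero])
          (fun t ht => (hg t ht).imp fun χ h v hv => h v (supp_subset_sphProd hN (hl v hv))),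
          zero_mul, add_zero]
  have h := hsnd S hS.le hSg hSτ
  rwa [hS] at h

end BorsukUlam

section BorsukUlam

/-- The sign of a function, with values in `ZMod 2`, and prescribed on the zero set. -/
noncomputable def signBit {Q : Type*} (f : Q → ℝ) (D : Q → ZMod 2) (u : Q) : ZMod 2 :=
  if f u < 0 then 1 else if 0 < f u then 0 else D u

lemma signBit_eq {Q : Type*} {f : Q → ℝ} {D : Q → ZMod 2} {u u' : Q} (hf : f u' = f u)
    (hD : D u' = D u) : signBit f D u' = signBit f D u := by
  simp [signBit, hf, hD]

lemma signBit_eq_add_one {Q : Type*} {f : Q → ℝ} {D : Q → ZMod 2} {u u' : Q} (hf : f u' = -f u)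
    (hD : D u' = D u + 1) : signBit f D u' = signBit f D u + 1 := by
  have h2 : (1 : ZMod 2) + 1 = 0 := CharTwo.add_self_eq_zero 1
  rcases lt_trichotomy (f u) 0 with h | h | h
  · simp [signBit, hf, h, h.le, h2]
  · simp [signBit, hf, h, hD]
  · simp [signBit, hf, h, h.not_gt]

open Classical in
/-- A set-theoretic choice of one element from each pair of antipodal vectors. -/
noncomputable def lexBit {d : ℕ} (x : Fin (d + 1) → ℝ) : ZMod 2 :=
  if toLex x < 0 then 1 else 0

lemma lexBit_neg {d : ℕ} {x : Fin (d + 1) → ℝ} (hx : x ≠ 0) : lexBit (-x) = lexBit x + 1 := by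
  have h2 : (1 : ZMod 2) + 1 = 0 := CharTwo.add_self_eq_zero 1
  have hx' : toLex x ≠ 0 := hx
  have h : toLex (-x) = -toLex x := rfl
  unfold lexBit
  rw [h]
  rcases lt_or_gt_of_ne hx' with h | h
  · have h₁ : toLex x < 0 := h
    have h₂ : ¬ -toLex x < 0 := (neg_pos.2 h).not_gt
    rw [if_pos h₁, if_neg h₂, h2]
  · have h₁ : ¬ toLex x < 0 := h.not_gt
    have h₂ : -toLex x < 0 := neg_lt_zero.2 h
    rw [if_neg h₁, if_pos h₂, zero_add]

lemma ne_zero_of_sum_sq {d : ℕ} {x : Fin (d + 1) → ℝ} (hx : ∑ i, x i ^ 2 = 1) : x ≠ 0 := by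
  rintro rfl
  simp at hx

lemma isCompact_sphProd (a b : ℕ) : IsCompact (sphProd a b) := by
  have h : ∀ d : ℕ, IsCompact {v : Fin (d + 1) → ℝ | ∑ i, v i ^ 2 = 1} := by
    intro d
    refine Metric.isCompact_of_isClosed_isBounded (isClosed_eq (by fun_prop) (by fun_prop)) ?_
    refine (Metric.isBounded_closedBall (x := (0 : Fin (d + 1) → ℝ)) (r := 1)).subset fun v hv => ?_
    rw [mem_closedBall_zero_iff, pi_norm_le_iff_of_nonneg zero_le_one]
    exact fun i => abs_le_one_of_mem_flag (k := d) ⟨hv, fun i hi => absurd i.2 (by omega)⟩ i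
  exact (h a).prod (h b)

/-- A Borsuk–Ulam theorem for functions on a product of two spheres, equivariant for the action
of `(ℤ/2)²` generated by `(v, x) ↦ (-v, x)` and `(v, x) ↦ (ρ v, -x)` with `ρ` a coordinate
reflection: the functions cannot be such that at each point one of them is continuous and
nonzero. -/
theorem exists_zero_or_discontinuity {a b : ℕ} {ι κ : Type*} [Fintype ι] [Fintype κ]
    (hι : Fintype.card ι = a) (hκ : Fintype.card κ = b) {ε : ℕ → ℝ} (hε : IsSign ε) (hεa : ε a = 1)
    (φ : ι → (Fin (a + 1) → ℝ) × (Fin (b + 1) → ℝ) → ℝ)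
    (ψ : κ → (Fin (a + 1) → ℝ) × (Fin (b + 1) → ℝ) → ℝ)
    (hφg : ∀ i, ∀ u ∈ sphProd a b, φ i (negFst u) = -φ i u)
    (hφτ : ∀ i, (∀ u ∈ sphProd a b, φ i (flipNeg ε u) = φ i u) ∨
      ∀ u ∈ sphProd a b, φ i (flipNeg ε u) = -φ i u)
    (hψg : ∀ j, ∀ u ∈ sphProd a b, ψ j (negFst u) = ψ j u)
    (hψτ : ∀ j, ∀ u ∈ sphProd a b, ψ j (flipNeg ε u) = -ψ j u) :
    ∃ u ∈ sphProd a b, (∀ i, ContinuousWithinAt (φ i) (sphProd a b) u → φ i u = 0) ∧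
      ∀ j, ContinuousWithinAt (ψ j) (sphProd a b) u → ψ j u = 0 := by
  classical
  by_contra! hcon
  have h2 : (1 : ZMod 2) + 1 = 0 := CharTwo.add_self_eq_zero 1
  set P := sphProd a b with hP
  let B : (Fin (a + 1) → ℝ) × (Fin (b + 1) → ℝ) → ZMod 2 := fun u => lexBit u.2
  let A : (Fin (a + 1) → ℝ) × (Fin (b + 1) → ℝ) → ZMod 2 := fun u =>
    if B u = 0 then lexBit u.1 else lexBit (flip ε u.1)
  have hBτ : ∀ u ∈ P, B (flipNeg ε u) = B u + 1 := fun u hu => lexBit_neg (ne_zero_of_sum_sq hu.2)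
  have hAg : ∀ u ∈ P, A (negFst u) = A u + 1 := by
    intro u hu
    have h1 : flip ε u.1 ≠ 0 := by
      intro h
      apply ne_zero_of_sum_sq hu.1
      rw [← flip_flip hε u.1, h]
      funext i; simp [flip]
    have hB : B (negFst u) = B u := rfl
    simp only [A, hB]
    by_cases h : B u = 0
    · simp only [h, if_true]; exact lexBit_neg (ne_zero_of_sum_sq hu.1)
    · simp only [h, if_false, negFst, flip_neg']; exact lexBit_neg h1
  have hAτ : ∀ u ∈ P, A (flipNeg ε u) = A u := by
    intro u hu
    simp only [A, hBτ u hu]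
    simp only [flipNeg, flip_flip hε]
    have h01 : ∀ β : ZMod 2, β + 1 = 0 ↔ β ≠ 0 := by decide
    by_cases h : B u = 0 <;> simp [h01, h]
  let s : ι → (Fin (a + 1) → ℝ) × (Fin (b + 1) → ℝ) → ZMod 2 := fun i =>
    if ∀ u ∈ P, φ i (flipNeg ε u) = φ i u then signBit (φ i) A
    else signBit (φ i) (fun u => A u + B u)
  let t : κ → (Fin (a + 1) → ℝ) × (Fin (b + 1) → ℝ) → ZMod 2 := fun j => signBit (ψ j) B
  have key : ∀ (f : (Fin (a + 1) → ℝ) × (Fin (b + 1) → ℝ) → ℝ) D, ∀ u ∈ P,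
      ContinuousWithinAt f P u → f u ≠ 0 → ∃ U, IsOpen U ∧ u ∈ U ∧
        ∀ v ∈ U ∩ P, ∀ w ∈ U ∩ P, signBit f D v = signBit f D w := by
    intro f D u hu hc h0
    have hev : ∃ χ, ∀ᶠ v in nhdsWithin u P, signBit f D v = χ := by
      rcases lt_or_gt_of_ne h0 with h | h
      · exact ⟨1, (hc.eventually_lt_const h).mono fun v hv => by simp [signBit, hv]⟩
      · exact ⟨0, (hc.eventually_const_lt h).mono fun v hv => by simp [signBit, hv, hv.not_gt]⟩
    obtain ⟨χ, hχ⟩ := hev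
    obtain ⟨U, hU, huU, hUP⟩ := mem_nhdsWithin.1 hχ
    exact ⟨U, hU, huU, fun v hv w hw => (hUP hv).trans (hUP hw).symm⟩
  have hsD : ∀ i, ∃ D, s i = signBit (φ i) D := by
    intro i
    by_cases h : ∀ u ∈ P, φ i (flipNeg ε u) = φ i u
    · exact ⟨_, if_pos h⟩
    · exact ⟨_, if_neg h⟩
  set S : List ((Fin (a + 1) → ℝ) × (Fin (b + 1) → ℝ) → ZMod 2) :=
    Finset.univ.toList.map t with hS
  set T : List ((Fin (a + 1) → ℝ) × (Fin (b + 1) → ℝ) → ZMod 2) :=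
    Finset.univ.toList.map s with hT
  have hloc : ∀ u : P, ∃ U, IsOpen U ∧ (u : (Fin (a + 1) → ℝ) × (Fin (b + 1) → ℝ)) ∈ U ∧
      ∃ r ∈ S ++ T, ∀ v ∈ U ∩ P, ∀ w ∈ U ∩ P, r v = r w := by
    rintro ⟨u, hu⟩
    by_cases h : ∀ i, ContinuousWithinAt (φ i) P u → φ i u = 0
    · obtain ⟨j, hj, hj0⟩ := hcon u hu h
      obtain ⟨U, hU, huU, h⟩ := key (ψ j) B u hu hj hj0
      exact ⟨U, hU, huU, t j, by simp [hS], h⟩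
    · push Not at h
      obtain ⟨i, hi, hi0⟩ := h
      obtain ⟨D, hD⟩ := hsD i
      obtain ⟨U, hU, huU, h⟩ := key (φ i) D u hu hi hi0
      exact ⟨U, hU, huU, s i, by simp [hT], hD ▸ h⟩
  choose U hU huU r hr hconst using hloc
  obtain ⟨δ, hδ, hleb⟩ := lebesgue_number_lemma_of_metric (isCompact_sphProd a b) hU
    (fun u hu => mem_iUnion.2 ⟨⟨u, hu⟩, huU ⟨u, hu⟩⟩)
  obtain ⟨N, hN⟩ := exists_nat_gt ((a + b : ℕ) * Real.pi / δ)
  have hN0 : 0 < N := by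
    have : (0 : ℝ) < N := lt_of_le_of_lt (by positivity) hN
    exact_mod_cast this
  have hsmall : (a + b : ℕ) * (Real.pi / (2 * N)) < δ := by
    have hN' : (0 : ℝ) < N := by exact_mod_cast hN0
    rw [div_lt_iff₀ hδ] at hN
    have : (a + b : ℕ) * (Real.pi / (2 * N)) = ((a + b : ℕ) * Real.pi) / N / 2 := by
      field_simp
    rw [this]
    have h3 : ((a + b : ℕ) * Real.pi) / N < δ := by rwa [div_lt_iff₀ hN', mul_comm δ]
    have h4 : 0 ≤ ((a + b : ℕ) * Real.pi) / N := by positivity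
    linarith
  have h1 := eval_cup_eq_one hN0 hε hεa S T (by simp [hS, hκ]) (by simp [hT, hι])
    (by
      simp only [hS, List.mem_map, Finset.mem_toList, Finset.mem_univ, true_and]
      rintro _ ⟨j, rfl⟩ u hu
      exact signBit_eq (hψg j u hu) rfl)
    (by
      simp only [hS, List.mem_map, Finset.mem_toList, Finset.mem_univ, true_and]
      rintro _ ⟨j, rfl⟩ u hu
      exact signBit_eq_add_one (hψτ j u hu) (hBτ u hu))
    (by
      simp only [hT, List.mem_map, Finset.mem_toList, Finset.mem_univ, true_and]
      rintro _ ⟨i, rfl⟩ u hu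
      simp only [s]
      split_ifs
      · exact signBit_eq_add_one (hφg i u hu) (hAg u hu)
      · refine signBit_eq_add_one (hφg i u hu) ?_
        have hB : B (negFst u) = B u := rfl
        rw [hAg u hu, hB]
        ring)
    (by
      simp only [hT, List.mem_map, Finset.mem_toList, Finset.mem_univ, true_and]
      rintro _ ⟨i, rfl⟩
      simp only [s]
      split_ifs with h
      · exact ⟨0, fun u hu => by rw [add_zero]; exact signBit_eq (h u hu) (hAτ u hu)⟩
      · have h' := (hφτ i).resolve_left h
        refine ⟨1, fun u hu => signBit_eq_add_one (h' u hu) ?_⟩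
        rw [hAτ u hu, hBτ u hu]
        ring)
  have h0 : (sphTower a b N hN0).eval (a + b) (cup (S ++ T)) =
      (sphTower a b N hN0).eval (a + b) 0 := by
    refine RotTower.eval_congr_small _ le_rfl fun l hl hd => ?_
    cases l with
    | nil => exact cup_nil_right _
    | cons u l =>
      have hlP : ∀ v ∈ u :: l, v ∈ P := fun v hv => supp_subset_sphProd hN0 (hl v hv)
      obtain ⟨i, hi⟩ := hleb u (hlP u (by simp))
      have hmem : ∀ v ∈ u :: l, v ∈ U i ∩ P := fun v hv =>
        ⟨hi (Metric.mem_ball.2 ((hd v hv u (by simp)).trans_lt hsmall)), hlP v hv⟩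
      exact cup_eq_zero_of_const (hr i) fun v hv w hw => hconst i v (hmem v hv) w (hmem w hw)
  have h00 : (sphTower a b N hN0).eval (a + b) 0 = 0 :=
    RotTower.eval_eq_zero _ le_rfl fun l _ => rfl
  rw [h1, h00] at h0
  exact one_ne_zero h0

end BorsukUlam

section ProjectiveSpace

variable {n : ℕ}

/-- The point of `ℂP^n` with given homogeneous coordinates. -/
def CP.mk (v : {v : Fin (n + 1) → ℂ // v ≠ 0}) : CP n := Quot.mk _ v

lemma CP.mk_surjective : Function.Surjective (CP.mk (n := n)) := Quot.mk_surjective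

lemma CP.continuous_mk : Continuous (CP.mk (n := n)) := continuous_quot_mk

lemma ne_zero_of_eq_smul {v w : Fin (n + 1) → ℂ} (hw : w ≠ 0) {c : ℂ} (h : w = c • v) : c ≠ 0 := by
  rintro rfl
  simp [h] at hw

lemma CP.mk_eq_iff {v w : {v : Fin (n + 1) → ℂ // v ≠ 0}} :
    CP.mk v = CP.mk w ↔ ∃ c : ℂ, (w : Fin (n + 1) → ℂ) = c • (v : Fin (n + 1) → ℂ) := by
  refine ⟨fun h => ?_, fun h => Quot.sound h⟩
  have h' := Quot.eqvGen_exact h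
  refine (Equivalence.eqvGen_iff ⟨fun v => ⟨1, by simp⟩, ?_, ?_⟩).1 h'
  · rintro v w ⟨c, hc⟩
    have hc0 := ne_zero_of_eq_smul w.2 hc
    exact ⟨c⁻¹, by rw [hc, smul_smul, inv_mul_cancel₀ hc0, one_smul]⟩
  · rintro u v w ⟨c, hc⟩ ⟨d, hd⟩
    exact ⟨d * c, by rw [hd, hc, smul_smul]⟩

lemma CP.isOpenMap_mk : IsOpenMap (CP.mk (n := n)) := by
  intro U hU
  have h : CP.mk ⁻¹' (CP.mk '' U) = ⋃ c : {c : ℂ // c ≠ 0},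
      (fun v : {v : Fin (n + 1) → ℂ // v ≠ 0} =>
        (⟨c.1 • v.1, smul_ne_zero c.2 v.2⟩ : {v : Fin (n + 1) → ℂ // v ≠ 0})) ⁻¹' U := by
    ext v
    simp only [mem_preimage, mem_image, mem_iUnion]
    constructor
    · rintro ⟨u, hu, huv⟩
      obtain ⟨c, hc⟩ := CP.mk_eq_iff.1 huv.symm
      refine ⟨⟨c, ne_zero_of_eq_smul u.2 hc⟩, ?_⟩
      convert hu using 1
      exact Subtype.ext hc.symm
    · rintro ⟨c, hc⟩
      exact ⟨_, hc, (CP.mk_eq_iff.2 ⟨c, rfl⟩).symm⟩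
  change IsOpen (CP.mk ⁻¹' (CP.mk '' U))
  rw [h]
  exact isOpen_iUnion fun c => hU.preimage (by fun_prop)

lemma CP.isOpenQuotientMap_mk : IsOpenQuotientMap (CP.mk (n := n)) :=
  ⟨CP.mk_surjective, CP.continuous_mk, CP.isOpenMap_mk⟩

lemma CP.continuous_iff {Z : Type*} [TopologicalSpace Z] {f : CP n → Z} :
    Continuous f ↔ Continuous fun v => f (CP.mk v) :=
  CP.isOpenQuotientMap_mk.isQuotientMap.continuous_iff

open scoped ComplexOrder in
lemma dotProduct_star_self_ne_zero {v : Fin (n + 1) → ℂ} (hv : v ≠ 0) : star v ⬝ᵥ v ≠ 0 :=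
  fun h => hv (dotProduct_star_self_eq_zero.1 h)

/-- The entries of the matrix of the orthogonal projection onto a line. -/
noncomputable def CP.proj (y : CP n) (i j : Fin (n + 1)) : ℂ :=
  Quot.lift (fun v : {v : Fin (n + 1) → ℂ // v ≠ 0} =>
    v.1 i * star (v.1 j) / (star v.1 ⬝ᵥ v.1)) (by
      rintro v w ⟨c, hc⟩
      have hc0 := ne_zero_of_eq_smul w.2 hc
      have hv := dotProduct_star_self_ne_zero v.2
      have hc1 : star c ≠ 0 := star_ne_zero.2 hc0
      simp only [hc, star_smul, smul_dotProduct, dotProduct_smul, Pi.smul_apply, smul_eq_mul,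
        star_mul']
      field_simp) y

lemma CP.proj_mk (v : {v : Fin (n + 1) → ℂ // v ≠ 0}) (i j : Fin (n + 1)) :
    (CP.mk v).proj i j = v.1 i * star (v.1 j) / (star v.1 ⬝ᵥ v.1) := rfl

lemma CP.continuous_proj (i j : Fin (n + 1)) : Continuous fun y : CP n => y.proj i j := by
  rw [CP.continuous_iff]
  simp only [CP.proj_mk, dotProduct, Pi.star_apply]
  have h (k : Fin (n + 1)) : Continuous fun v : {v : Fin (n + 1) → ℂ // v ≠ 0} => v.1 k :=
    (continuous_apply k).comp continuous_subtype_val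
  exact Continuous.div ((h i).mul (h j).star)
    (continuous_finsetSum _ fun k _ => (h k).star.mul (h k))
    fun v => dotProduct_star_self_ne_zero v.2

lemma CP.proj_injective : Function.Injective (CP.proj (n := n)) := by
  intro y y' h
  obtain ⟨v, rfl⟩ := CP.mk_surjective y
  obtain ⟨w, rfl⟩ := CP.mk_surjective y'
  obtain ⟨j, hj⟩ := Function.ne_iff.1 w.2
  have hw := dotProduct_star_self_ne_zero w.2
  refine CP.mk_eq_iff.2 ⟨(star (v.1 j) / (star v.1 ⬝ᵥ v.1)) * (star w.1 ⬝ᵥ w.1) / star (w.1 j), ?_⟩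
  funext i
  have hi := congrFun (congrFun h i) j
  rw [CP.proj_mk, CP.proj_mk, eq_div_iff hw] at hi
  have hj' : star (w.1 j) ≠ 0 := star_ne_zero.2 hj
  rw [Pi.smul_apply, smul_eq_mul, div_mul_eq_mul_div, eq_div_iff hj', ← hi]
  ring

instance : T2Space (CP n) :=
  T2Space.of_injective_continuous CP.proj_injective
    (continuous_pi fun i => continuous_pi fun j => CP.continuous_proj i j)

instance : CompactSpace (CP n) := by
  have hS : IsCompact (Metric.sphere (0 : Fin (n + 1) → ℂ) 1) := isCompact_sphere _ _
  let f : Metric.sphere (0 : Fin (n + 1) → ℂ) 1 → CP n := fun v =>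
    CP.mk ⟨v, ne_zero_of_mem_unit_sphere v⟩
  have hf : Continuous f := CP.continuous_mk.comp (by fun_prop)
  have : CompactSpace (Metric.sphere (0 : Fin (n + 1) → ℂ) 1) := isCompact_iff_compactSpace.1 hS
  refine ⟨?_⟩
  convert isCompact_range hf
  symm
  rw [eq_univ_iff_forall]
  intro y
  obtain ⟨v, rfl⟩ := CP.mk_surjective y
  have hv : ‖v.1‖ ≠ 0 := norm_ne_zero_iff.2 v.2
  refine ⟨⟨((‖v.1‖⁻¹ : ℝ) : ℂ) • v.1, ?_⟩, (CP.mk_eq_iff.2 ⟨_, rfl⟩).symm⟩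
  rw [mem_sphere_zero_iff_norm, norm_smul, Complex.norm_real, norm_inv, norm_norm,
    inv_mul_cancel₀ hv]

lemma star_ne_zero' {v : Fin (n + 1) → ℂ} (hv : v ≠ 0) : star v ≠ 0 := star_ne_zero.2 hv

lemma cpConj_mk (v : {v : Fin (n + 1) → ℂ // v ≠ 0}) :
    cpConj n (CP.mk v) = CP.mk ⟨star v.1, star_ne_zero' v.2⟩ := rfl

lemma continuous_cpConj : Continuous (cpConj n) := by
  rw [CP.continuous_iff]
  simp only [cpConj_mk]
  exact CP.continuous_mk.comp (by fun_prop)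

lemma cpConj_cpConj (y : CP n) : cpConj n (cpConj n y) = y := by
  obtain ⟨v, rfl⟩ := CP.mk_surjective y
  simp [cpConj_mk]

lemma CP.proj_cpConj (y : CP n) (i j : Fin (n + 1)) : (cpConj n y).proj i j = star (y.proj i j) := by
  obtain ⟨v, rfl⟩ := CP.mk_surjective y
  rw [cpConj_mk, CP.proj_mk, CP.proj_mk, star_div₀, star_mul', ← Matrix.star_dotProduct_star]
  simp [dotProduct_comm]

end ProjectiveSpace

section Cover

variable {n r : ℕ} {m : Fin r → ℕ}

/-- The double cover of the generalized projective product space. -/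
abbrev DoubleCover (n r : ℕ) (m : Fin r → ℕ) : Type := CP n × (∀ i, Sph (m i))

/-- The deck transformation of the double cover. -/
noncomputable def deck (y : DoubleCover n r m) : DoubleCover n r m :=
  (cpConj n y.1, fun i => negSph (m i) (y.2 i))

/-- The projection of the double cover. -/
def coverProj (y : DoubleCover n r m) : CPGPP n r m := Quot.mk _ y

lemma norm_coe_sph {k : ℕ} (x : Sph k) : ‖(x : EuclideanSpace ℝ (Fin (k + 1)))‖ = 1 :=
  mem_sphere_zero_iff_norm.1 x.2

lemma continuous_negSph (k : ℕ) : Continuous (negSph k) := by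
  unfold negSph
  fun_prop

@[simp] lemma coe_negSph (k : ℕ) (x : Sph k) :
    (negSph k x : EuclideanSpace ℝ (Fin (k + 1))) = -x := rfl

lemma continuous_deck : Continuous (deck (n := n) (m := m)) := by
  unfold deck
  exact (continuous_cpConj.comp continuous_fst).prodMk
    (continuous_pi fun i => (continuous_negSph _).comp ((continuous_apply i).comp continuous_snd))

@[simp] lemma deck_deck (y : DoubleCover n r m) : deck (deck y) = y := by
  ext1
  · exact cpConj_cpConj _
  · funext i
    ext1
    simp [deck]

lemma deck_ne (hr : 0 < r) (y : DoubleCover n r m) : deck y ≠ y := by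
  intro h
  have h1 := congrArg Subtype.val (congrFun (congrArg Prod.snd h) ⟨0, hr⟩)
  have h2 := norm_coe_sph (y.2 ⟨0, hr⟩)
  have : IsAddTorsionFree (EuclideanSpace ℝ (Fin (m ⟨0, hr⟩ + 1))) := .of_module_rat _
  rw [self_eq_neg.1 h1.symm, norm_zero] at h2
  exact zero_ne_one h2

lemma coverProj_surjective : Function.Surjective (coverProj (n := n) (m := m)) :=
  Quot.mk_surjective

lemma continuous_coverProj : Continuous (coverProj (n := n) (m := m)) := continuous_quot_mk

lemma coverProj_deck (y : DoubleCover n r m) : coverProj (deck y) = coverProj y :=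
  (show coverProj y = coverProj (deck y) from Quot.sound (r := fun a b : DoubleCover n r m =>
    b = (cpConj n a.1, fun i => negSph (m i) (a.2 i))) rfl).symm

lemma coverProj_eq_iff {y y' : DoubleCover n r m} :
    coverProj y = coverProj y' ↔ y' = y ∨ y' = deck y := by
  constructor
  · intro h
    have h' := Quot.eqvGen_exact h
    clear h
    induction h' with
    | rel y y' h => exact Or.inr h
    | refl y => exact Or.inl rfl
    | symm y y' _ ih =>
      rcases ih with rfl | rfl
      · exact Or.inl rfl
      · exact Or.inr (deck_deck _).symm
    | trans y y' y'' _ _ ih ih' =>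
      rcases ih with rfl | rfl <;> rcases ih' with rfl | rfl <;> simp
  · rintro (rfl | rfl)
    · rfl
    · exact (coverProj_deck y).symm

lemma isOpenMap_coverProj : IsOpenMap (coverProj (n := n) (m := m)) := by
  intro U hU
  have h : coverProj ⁻¹' (coverProj '' U) = U ∪ deck ⁻¹' U := by
    ext y
    constructor
    · rintro ⟨u, hu, huy⟩
      rcases coverProj_eq_iff.1 huy with rfl | rfl
      · exact Or.inl hu
      · exact Or.inr (by simpa using hu)
    · rintro (h | h)
      · exact ⟨y, h, rfl⟩
      · exact ⟨_, h, coverProj_deck y⟩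
  change IsOpen (coverProj ⁻¹' (coverProj '' U))
  rw [h]
  exact hU.union (hU.preimage continuous_deck)

lemma isOpenQuotientMap_coverProj : IsOpenQuotientMap (coverProj (n := n) (m := m)) :=
  ⟨coverProj_surjective, continuous_coverProj, isOpenMap_coverProj⟩

end Cover

section DoubleCovering

variable {X Y : Type*} [TopologicalSpace X] [TopologicalSpace Y] {p : Y → X} {τ : Y → Y}

lemma isClosedMap_of_involution (hp : IsOpenQuotientMap p) (hτ : Continuous τ)
    (hττ : ∀ y, τ (τ y) = y) (hpτ : ∀ y y', p y = p y' ↔ y' = y ∨ y' = τ y) : IsClosedMap p := by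
  intro C hC
  rw [← hp.isQuotientMap.isClosed_preimage]
  have h : p ⁻¹' (p '' C) = C ∪ τ ⁻¹' C := by
    ext y
    constructor
    · rintro ⟨u, hu, huy⟩
      rcases (hpτ _ _).1 huy with rfl | rfl
      · exact Or.inl hu
      · exact Or.inr (by simpa [hττ] using hu)
    · rintro (h | h)
      · exact ⟨y, h, rfl⟩
      · exact ⟨_, h, (hpτ _ _).2 (Or.inr (hττ y).symm)⟩
  rw [h]
  exact hC.union (hC.preimage hτ)

lemma isCoveringMap_of_involution [T2Space Y] (hp : IsOpenQuotientMap p)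
    (hτ : Continuous τ) (hττ : ∀ y, τ (τ y) = y) (hne : ∀ y, τ y ≠ y)
    (hpτ : ∀ y y', p y = p y' ↔ y' = y ∨ y' = τ y) : IsCoveringMap p := by
  rw [isCoveringMap_iff_isCoveringMapOn_univ]
  refine (isClosedMap_of_involution hp hτ hττ hpτ).isCoveringMapOn_of_isLocalHomeomorphOn
    (fun x _ => ?_) ?_
  · obtain ⟨y, rfl⟩ := hp.surjective x
    refine (Set.toFinite {y, τ y}).subset fun z hz => ?_
    exact (hpτ _ _).1 (show p z = p y from hz).symm
  · rw [preimage_univ, ← isLocalHomeomorph_iff_isLocalHomeomorphOn_univ,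
      isLocalHomeomorph_iff_isOpenEmbedding_restrict]
    intro y
    obtain ⟨U, V, hU, hV, hyU, hyV, hd⟩ := t2_separation (hne y).symm
    refine ⟨U ∩ τ ⁻¹' V, (hU.inter (hV.preimage hτ)).mem_nhds ⟨hyU, hyV⟩, ?_⟩
    refine .of_continuous_injective_isOpenMap (hp.continuous.comp continuous_subtype_val) ?_
      (hp.isOpenMap.comp (hU.inter (hV.preimage hτ)).isOpenMap_subtype_val)
    rintro ⟨a, ha⟩ ⟨b, hb⟩ hab
    rcases (hpτ _ _).1 (show p a = p b from hab) with rfl | rfl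
    · rfl
    · exact absurd ha.2 (hd.notMem_of_mem_left hb.1)

open unitInterval in
lemma exists_lift_of_nullhomotopic [T2Space Y] (hp : IsOpenQuotientMap p)
    (hτ : Continuous τ) (hττ : ∀ y, τ (τ y) = y) (hne : ∀ y, τ y ≠ y)
    (hpτ : ∀ y y', p y = p y' ↔ y' = y ∨ y' = τ y) {U : Set X}
    (hU : (⟨Subtype.val, continuous_subtype_val⟩ : C(U, X)).Nullhomotopic) :
    ∃ (y : Y) (G : C(I × (p ⁻¹' U), Y)), (∀ a, G (0, a) = a) ∧
      (∀ t (a b : p ⁻¹' U), (b : Y) = τ a → G (t, b) = τ (G (t, a))) ∧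
      ∀ a, G (1, a) = y ∨ G (1, a) = τ y := by
  have cov := isCoveringMap_of_involution hp hτ hττ hne hpτ
  obtain ⟨x, ⟨F⟩⟩ := hU
  obtain ⟨y, rfl⟩ := hp.surjective x
  have hpU (b : Y) : p (τ b) = p b := (hpτ _ _).2 (Or.inr (hττ b).symm)
  let θ : C(p ⁻¹' U, p ⁻¹' U) :=
    ⟨fun a => ⟨τ a, by have := a.2; rwa [mem_preimage, hpU]⟩, by fun_prop⟩
  have hcont : Continuous p := hp.continuous
  let H : C(I × (p ⁻¹' U), X) :=
    ⟨fun ta => F (ta.1, ⟨p ta.2, ta.2.2⟩), by fun_prop⟩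
  let f : C(p ⁻¹' U, Y) := ⟨Subtype.val, continuous_subtype_val⟩
  have H0 (a) : H (0, a) = p (f a) := F.apply_zero _
  let G := cov.liftHomotopy H f H0
  have hG (t a) : p (G (t, a)) = H (t, a) := congrFun (cov.liftHomotopy_lifts H f H0) (t, a)
  have hG0 (a) : G (0, a) = a := cov.liftHomotopy_zero H f H0 a
  refine ⟨y, G, hG0, ?_, fun a => ?_⟩
  · let G' : C(I × (p ⁻¹' U), Y) := ⟨fun ta => τ (G (ta.1, θ ta.2)), by fun_prop⟩
    have hG' : G' = G := by
      refine (cov.eq_liftHomotopy_iff' H0 G').2 ⟨?_, fun a => ?_⟩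
      · funext ⟨t, a⟩
        change p (τ (G (t, θ a))) = H (t, a)
        rw [hpU, hG]
        change F (t, ⟨p (τ a), _⟩) = F (t, ⟨p a, _⟩)
        simp only [hpU]
      · change τ (G (0, θ a)) = a
        rw [hG0]
        exact hττ a
    intro t a b hb
    obtain rfl : b = θ a := Subtype.ext hb
    have := congrArg (fun g : C(I × (p ⁻¹' U), Y) => g (t, a)) hG'
    change τ (G (t, θ a)) = G (t, a) at this
    rw [← this, hττ]
  · refine (hpτ _ _).1 ?_
    rw [hG]
    exact (F.apply_one _).symm

/-- A homotopy of an open set can be cut off to a homotopy of the whole space. -/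
lemma exists_equivariant_cutoff [T2Space Y] [CompactSpace Y]
    (hτ : Continuous τ) (hττ : ∀ y, τ (τ y) = y) {A W : Set Y} (hA : IsOpen A)
    (hAτ : ∀ a ∈ A, τ a ∈ A) (hWA : closure W ⊆ A) (G : C(unitInterval × A, Y))
    (hG0 : ∀ a, G (0, a) = a) (hGτ : ∀ t (a b : A), (b : Y) = τ a → G (t, b) = τ (G (t, a))) :
    ∃ Γ : ℝ × Y → Y, Continuous Γ ∧ (∀ y, Γ (0, y) = y) ∧ (∀ t y, Γ (t, τ y) = τ (Γ (t, y))) ∧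
      ∀ a : A, ((a : Y) ∈ W ∨ τ a ∈ W) → Γ (1, a) = G (1, a) := by
  classical
  obtain ⟨ψ, hψ1, -, hψA, hψI⟩ :=
    exists_continuousMap_one_of_isCompact_subset_isOpen isClosed_closure.isCompact hA hWA
  let χ : Y → ℝ := fun y => max (ψ y) (ψ (τ y))
  have hχ : Continuous χ := by fun_prop
  have hχτ (y) : χ (τ y) = χ y := by simp only [χ, hττ, max_comm]
  let K := tsupport ψ ∪ τ ⁻¹' tsupport ψ
  have hK : IsClosed K := (isClosed_tsupport _).union ((isClosed_tsupport _).preimage hτ)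
  have hKA : K ⊆ A := by
    rintro y (h | h)
    · exact hψA h
    · have := hAτ _ (hψA h)
      rwa [hττ] at this
  have hχK (y) (hy : y ∉ K) : χ y = 0 := by
    have h1 : y ∉ tsupport ψ := fun h => hy (Or.inl h)
    have h2 : τ y ∉ tsupport ψ := fun h => hy (Or.inr h)
    simp [χ, image_eq_zero_of_notMem_tsupport h1, image_eq_zero_of_notMem_tsupport h2]
  let s : ℝ × Y → unitInterval := fun ty => projIcc 0 1 zero_le_one (ty.1 * χ ty.2)
  have hs : Continuous s := by fun_prop
  let Γ : ℝ × Y → Y := fun ty => if h : ty.2 ∈ A then G (s ty, ⟨ty.2, h⟩) else ty.2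
  have hs0 (ty : ℝ × Y) (h : ty.1 * χ ty.2 = 0) : s ty = 0 := by
    simp only [s, h]
    exact projIcc_left _
  have hΓ0 (ty : ℝ × Y) (h : ty.1 * χ ty.2 = 0) : Γ ty = ty.2 := by
    simp only [Γ]
    split_ifs
    · rw [hs0 ty h, hG0]
    · rfl
  refine ⟨Γ, ?_, fun y => hΓ0 _ (zero_mul _), fun t y => ?_, fun a ha => ?_⟩
  · rw [continuous_iff_continuousAt]
    intro ty
    by_cases h : ty.2 ∈ K
    · have hO : IsOpen (Prod.snd ⁻¹' A : Set (ℝ × Y)) := hA.preimage continuous_snd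
      refine ContinuousOn.continuousAt ?_ (hO.mem_nhds (hKA h))
      rw [continuousOn_iff_continuous_domRestrict]
      have : (Prod.snd ⁻¹' A : Set (ℝ × Y)).domRestrict Γ =
          fun u : (Prod.snd ⁻¹' A : Set (ℝ × Y)) => G (s u, ⟨u.1.2, u.2⟩) := by
        funext u
        exact dif_pos u.2
      rw [this]
      fun_prop
    · have hO : IsOpen (Prod.snd ⁻¹' Kᶜ : Set (ℝ × Y)) := hK.isOpen_compl.preimage continuous_snd
      refine continuous_snd.continuousAt.congr ?_
      filter_upwards [hO.mem_nhds h] with u hu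
      exact (hΓ0 u (by rw [hχK _ hu, mul_zero])).symm
  · have hs' : s (t, τ y) = s (t, y) := by simp only [s, hχτ]
    by_cases h : y ∈ A
    · have h' := hAτ y h
      simp only [Γ, h, h', dif_pos, hs']
      exact hGτ _ _ _ rfl
    · have h' : τ y ∉ A := fun h' => h (by simpa [hττ] using hAτ _ h')
      simp only [Γ, h, h', dif_neg, not_false_eq_true]
  · have hχ1 : χ a = 1 := by
      have h1 (y) : ψ y ≤ 1 := (hψI y).2
      refine le_antisymm (max_le (h1 _) (h1 _)) ?_
      rcases ha with ha | ha
      · exact le_max_of_le_left (hψ1 (subset_closure ha)).ge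
      · exact le_max_of_le_right (hψ1 (subset_closure ha)).ge
    have : s (1, (a : Y)) = 1 := by
      simp only [s, hχ1, mul_one]
      exact projIcc_right _
    simp only [Γ, a.2, dif_pos, this]

lemma exists_equivariant_deformation [T2Space Y] [CompactSpace Y] (hp : IsOpenQuotientMap p)
    (hτ : Continuous τ) (hττ : ∀ y, τ (τ y) = y) (hne : ∀ y, τ y ≠ y)
    (hpτ : ∀ y y', p y = p y' ↔ y' = y ∨ y' = τ y) {k : ℕ} (hX : HasCatCover X k) :
    ∃ (V : Fin k → Set Y) (y : Fin k → Y) (Γ : Fin k → ℝ × Y → Y),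
      (∀ l, IsOpen (V l)) ∧ (∀ l, ∀ ξ, τ ξ ∈ V l ↔ ξ ∈ V l) ∧ (∀ ξ, ∃ l, ξ ∈ V l) ∧
      (∀ l, Continuous (Γ l)) ∧ (∀ l ξ, Γ l (0, ξ) = ξ) ∧
      (∀ l t ξ, Γ l (t, τ ξ) = τ (Γ l (t, ξ))) ∧
      ∀ l, ∀ ξ ∈ V l, Γ l (1, ξ) = y l ∨ Γ l (1, ξ) = τ (y l) := by
  obtain ⟨U, hU, hUc, hUn⟩ := hX
  choose y G hG0 hGτ hG1 using fun l => exists_lift_of_nullhomotopic hp hτ hττ hne hpτ (hUn l)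
  have hUp (l) : IsOpen (p ⁻¹' U l) := (hU l).preimage hp.continuous
  obtain ⟨v, hvc, hv, hvU⟩ := exists_iUnion_eq_closure_subset hUp
    (fun _ => toFinite _) (by rw [← preimage_iUnion, hUc, preimage_univ])
  have hpU (b : Y) : p (τ b) = p b := (hpτ _ _).2 (Or.inr (hττ b).symm)
  have hUτ (l) : ∀ a ∈ p ⁻¹' U l, τ a ∈ p ⁻¹' U l := fun a ha => by rwa [mem_preimage, hpU]
  choose Γ hΓ hΓ0 hΓτ hΓ1 using fun l =>
    exists_equivariant_cutoff hτ hττ (hUp l) (hUτ l) (hvU l) (G l) (hG0 l) (hGτ l)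
  refine ⟨fun l => v l ∪ τ ⁻¹' v l, y, Γ, fun l => (hv l).union ((hv l).preimage hτ),
    fun l ξ => ?_, fun ξ => ?_, hΓ, hΓ0, hΓτ, fun l ξ hξ => ?_⟩
  · simp only [mem_union, mem_preimage, hττ, or_comm]
  · obtain ⟨l, hl⟩ := mem_iUnion.1 (hvc.ge (mem_univ ξ))
    exact ⟨l, Or.inl hl⟩
  · have hξU : ξ ∈ p ⁻¹' U l := by
      rcases hξ with h | h
      · exact hvU l (subset_closure h)
      · have := hvU l (subset_closure h)
        rwa [mem_preimage, hpU] at this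
    rw [hΓ1 l ⟨ξ, hξU⟩ hξ]
    exact hG1 l _

end DoubleCovering

section Projector

variable {n : ℕ}

/-- The orthogonal projection onto a line. -/
noncomputable def CP.projector (y : CP n) : Matrix (Fin (n + 1)) (Fin (n + 1)) ℂ :=
  Matrix.of y.proj

lemma CP.continuous_projector : Continuous (CP.projector (n := n)) :=
  continuous_matrix CP.continuous_proj

lemma CP.projector_cpConj (y : CP n) : (cpConj n y).projector = y.projector.map star := by
  ext i j
  exact CP.proj_cpConj y i j

lemma CP.projector_mk_mulVec (v : {v : Fin (n + 1) → ℂ // v ≠ 0}) (u : Fin (n + 1) → ℂ) :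
    (CP.mk v).projector.mulVec u = ((star v.1 ⬝ᵥ u) / (star v.1 ⬝ᵥ v.1)) • v.1 := by
  funext i
  simp only [Matrix.mulVec, CP.projector, Matrix.of_apply, CP.proj_mk, Pi.smul_apply, smul_eq_mul]
  simp only [dotProduct, Pi.star_apply, Finset.sum_div, Finset.sum_mul]
  exact Finset.sum_congr rfl fun j _ => by ring

/-- The squared cosine of the angle between two lines. -/
noncomputable def CP.overlap (y y' : CP n) : ℂ := (y.projector * y'.projector).trace

lemma CP.overlap_mk (v u : {v : Fin (n + 1) → ℂ // v ≠ 0}) :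
    (CP.mk v).overlap (CP.mk u) =
      ((star v.1 ⬝ᵥ u.1) * (star u.1 ⬝ᵥ v.1)) / ((star v.1 ⬝ᵥ v.1) * (star u.1 ⬝ᵥ u.1)) := by
  simp only [CP.overlap, Matrix.trace, Matrix.diag, Matrix.mul_apply, CP.projector,
    Matrix.of_apply, CP.proj_mk]
  simp only [dotProduct, Pi.star_apply]
  rw [Finset.sum_mul_sum, Finset.sum_comm, Finset.sum_div]
  refine Finset.sum_congr rfl fun i _ => ?_
  rw [Finset.sum_div]
  refine Finset.sum_congr rfl fun j _ => ?_
  rw [div_mul_div_comm]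
  ring

lemma CP.overlap_self (y : CP n) : y.overlap y = 1 := by
  obtain ⟨v, rfl⟩ := CP.mk_surjective y
  have := dotProduct_star_self_ne_zero v.2
  rw [CP.overlap_mk]
  field_simp

lemma CP.continuous_overlap : Continuous fun y : CP n × CP n => y.1.overlap y.2 :=
  ((CP.continuous_projector.comp continuous_fst).matrix_mul
    (CP.continuous_projector.comp continuous_snd)).matrix_trace

lemma CP.mk_projector_mulVec {y : CP n} {u : {v : Fin (n + 1) → ℂ // v ≠ 0}}
    (h : y.overlap (CP.mk u) ≠ 0) :
    ∃ h : y.projector.mulVec u.1 ≠ 0, CP.mk ⟨y.projector.mulVec u.1, h⟩ = y := by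
  obtain ⟨v, rfl⟩ := CP.mk_surjective y
  have hv := dotProduct_star_self_ne_zero v.2
  have h0 : star v.1 ⬝ᵥ u.1 ≠ 0 := fun h0 => h (by rw [CP.overlap_mk, h0, zero_mul, zero_div])
  have h1 : (CP.mk v).projector.mulVec u.1 ≠ 0 := by
    rw [CP.projector_mk_mulVec]
    exact smul_ne_zero (div_ne_zero h0 hv) v.2
  exact ⟨h1, (CP.mk_eq_iff.2 ⟨_, CP.projector_mk_mulVec v u.1⟩).symm⟩

end Projector

section Labels

variable {n r : ℕ} {m : Fin r → ℕ}

lemma exists_overlap_ne_zero {Γ : ℝ × DoubleCover n r m → DoubleCover n r m} (hΓ : Continuous Γ) :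
    ∃ δ > 0, ∀ s ∈ Icc (0 : ℝ) 1, ∀ t ∈ Icc (0 : ℝ) 1, |s - t| < δ →
      ∀ ξ, (Γ (s, ξ)).1.overlap (Γ (t, ξ)).1 ≠ 0 := by
  have h₁ : Continuous fun p : (ℝ × ℝ) × DoubleCover n r m => (Γ (p.1.1, p.2)).1 := by fun_prop
  have h₂ : Continuous fun p : (ℝ × ℝ) × DoubleCover n r m => (Γ (p.1.2, p.2)).1 := by fun_prop
  have hf := CP.continuous_overlap.comp (h₁.prodMk h₂)
  have hK : IsCompact ((Icc (0 : ℝ) 1 ×ˢ Icc (0 : ℝ) 1) ×ˢ (univ : Set (DoubleCover n r m))) :=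
    (isCompact_Icc.prod isCompact_Icc).prod isCompact_univ
  have hKB := hK.inter_right (isClosed_singleton.preimage hf (t := {0}))
  have hg : Continuous fun p : (ℝ × ℝ) × DoubleCover n r m => |p.1.1 - p.1.2| := by fun_prop
  obtain ⟨δ, hδ, hδB⟩ := hKB.exists_forall_le' hg.continuousOn (a := 0) (by
    intro p hp
    refine abs_pos.2 fun h => one_ne_zero (α := ℂ) ?_
    have h' : (Γ (p.1.1, p.2)).1.overlap (Γ (p.1.2, p.2)).1 = 0 := hp.2
    rwa [sub_eq_zero.1 h, CP.overlap_self] at h')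
  exact ⟨δ, hδ, fun s hs t ht hst ξ h0 =>
    not_lt.2 (hδB ((s, t), ξ) ⟨⟨⟨hs, ht⟩, mem_univ _⟩, h0⟩) hst⟩

/-- Parallel transport along a homotopy of the tautological line bundle over `ℂP^n`. -/
lemma exists_transport {Γ : ℝ × DoubleCover n r m → DoubleCover n r m} (hΓ : Continuous Γ)
    (hΓ0 : ∀ ξ, Γ (0, ξ) = ξ) (hΓτ : ∀ t ξ, Γ (t, deck ξ) = deck (Γ (t, ξ))) :
    ∃ P : DoubleCover n r m → Matrix (Fin (n + 1)) (Fin (n + 1)) ℂ, Continuous P ∧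
      (∀ ξ, P (deck ξ) = (P ξ).map star) ∧
      ∀ (ξ : DoubleCover n r m) (u : {v : Fin (n + 1) → ℂ // v ≠ 0}), CP.mk u = ξ.1 →
        ∃ h : (P ξ).mulVec u.1 ≠ 0, CP.mk ⟨(P ξ).mulVec u.1, h⟩ = (Γ (1, ξ)).1 := by
  obtain ⟨δ, hδ, hδB⟩ := exists_overlap_ne_zero hΓ
  obtain ⟨N, hN⟩ := exists_nat_one_div_lt hδ
  let N' : ℝ := N + 1
  have hN' : 0 < N' := by positivity
  let P : ℕ → DoubleCover n r m → Matrix (Fin (n + 1)) (Fin (n + 1)) ℂ := fun j =>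
    Nat.rec (fun _ => 1) (fun j Q ξ => (Γ ((j + 1 : ℕ) / N', ξ)).1.projector * Q ξ) j
  have hP0 (ξ) : P 0 ξ = 1 := rfl
  have hP1 (j ξ) : P (j + 1) ξ = (Γ ((j + 1 : ℕ) / N', ξ)).1.projector * P j ξ := rfl
  have hPc (j) : Continuous (P j) := by
    induction j with
    | zero => exact continuous_const
    | succ j ih =>
      have : P (j + 1) = fun ξ => (Γ ((j + 1 : ℕ) / N', ξ)).1.projector * P j ξ := rfl
      rw [this]
      exact (CP.continuous_projector.comp (by fun_prop)).matrix_mul ih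
  have hPτ (j ξ) : P j (deck ξ) = (P j ξ).map star := by
    induction j with
    | zero => simp [hP0, Matrix.map_one]
    | succ j ih =>
      rw [hP1, hP1, ih, hΓτ]
      change (cpConj n _).projector * _ = _
      rw [CP.projector_cpConj]
      exact (Matrix.map_mul (f := starRingEnd ℂ)).symm
  have hPm (j) (hj : j ≤ N + 1) (ξ : DoubleCover n r m) (u : {v : Fin (n + 1) → ℂ // v ≠ 0})
      (hu : CP.mk u = ξ.1) : ∃ h : (P j ξ).mulVec u.1 ≠ 0,
        CP.mk ⟨(P j ξ).mulVec u.1, h⟩ = (Γ (j / N', ξ)).1 := by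
    induction j with
    | zero => simpa [hP0, hΓ0] using ⟨u.2, hu⟩
    | succ j ih =>
      obtain ⟨h, hmk⟩ := ih (by omega)
      have hj' : ((j + 1 : ℕ) : ℝ) ≤ N' := by
        simp only [N']
        exact_mod_cast hj
      have hov : (Γ ((j + 1 : ℕ) / N', ξ)).1.overlap (CP.mk ⟨(P j ξ).mulVec u.1, h⟩) ≠ 0 := by
        rw [hmk]
        refine hδB _ ⟨by positivity, ?_⟩ _ ⟨by positivity, ?_⟩ ?_ ξ
        · exact (div_le_one hN').2 hj'
        · exact (div_le_one hN').2 (le_trans (by simp) hj')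
        · rwa [← sub_div, Nat.cast_succ, add_sub_cancel_left, abs_of_pos (by positivity)]
      simpa only [hP1, Matrix.mulVec_mulVec] using CP.mk_projector_mulVec hov
  refine ⟨P (N + 1), hPc (N + 1), hPτ (N + 1), fun ξ u hu => ?_⟩
  have := hPm (N + 1) le_rfl ξ u hu
  rwa [show ((N + 1 : ℕ) : ℝ) / N' = 1 by simp [N', div_self hN'.ne']] at this

/-- The height function on the `i`-th sphere factor in the direction of `q`. -/
noncomputable def height (i : Fin r) (q ξ : DoubleCover n r m) : ℝ :=
  inner ℝ (q.2 i : EuclideanSpace ℝ (Fin (m i + 1))) (ξ.2 i)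

lemma continuous_height (i : Fin r) (q : DoubleCover n r m) : Continuous (height i q) := by
  unfold height
  exact continuous_const.inner
    (continuous_subtype_val.comp ((continuous_apply i).comp continuous_snd))

lemma height_deck (i : Fin r) (q ξ : DoubleCover n r m) : height i q (deck ξ) = -height i q ξ := by
  simp [height, deck]

lemma height_self (i : Fin r) (q : DoubleCover n r m) : height i q q = 1 := by
  simp [height]

lemma exists_line_function (i₀ : Fin r) {Γ : ℝ × DoubleCover n r m → DoubleCover n r m}
    (hΓ : Continuous Γ)
    (hΓ0 : ∀ ξ, Γ (0, ξ) = ξ) (hΓτ : ∀ t ξ, Γ (t, deck ξ) = deck (Γ (t, ξ)))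
    (V : Set (DoubleCover n r m)) (q : DoubleCover n r m)
    (hq : ∀ ξ ∈ V, Γ (1, ξ) = q ∨ Γ (1, ξ) = deck q) :
    ∃ f : DoubleCover n r m × (Fin (n + 1) → ℂ) → ℂ, Continuous f ∧
      (∀ ξ u, f (ξ, -u) = -f (ξ, u)) ∧ (∀ ξ u, f (deck ξ, star u) = star (f (ξ, u))) ∧
      ∀ ξ ∈ V, ∀ u : {v : Fin (n + 1) → ℂ // v ≠ 0}, CP.mk u = ξ.1 → f (ξ, u) ≠ 0 := by
  obtain ⟨P, hP, hPτ, hPm⟩ := exists_transport hΓ hΓ0 hΓτ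
  obtain ⟨w, hw⟩ := CP.mk_surjective q.1
  let c : DoubleCover n r m → ℝ := fun ξ => height i₀ q (Γ (1, ξ))
  have hc : Continuous c := (continuous_height i₀ q).comp (by fun_prop)
  have hcτ (ξ) : c (deck ξ) = -c ξ := by simp only [c, hΓτ, height_deck]
  have hdot : Continuous fun p : (Fin (n + 1) → ℂ) × (Fin (n + 1) → ℂ) => p.1 ⬝ᵥ p.2 := by
    unfold dotProduct
    fun_prop
  have hPu : Continuous fun p : DoubleCover n r m × (Fin (n + 1) → ℂ) => (P p.1).mulVec p.2 :=
    (hP.comp continuous_fst).matrix_mulVec continuous_snd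
  refine ⟨fun p => ((1 + c p.1) / 2 : ℝ) * (star w.1 ⬝ᵥ (P p.1).mulVec p.2) +
    ((1 - c p.1) / 2 : ℝ) * (w.1 ⬝ᵥ (P p.1).mulVec p.2), ?_, fun ξ u => ?_, fun ξ u => ?_,
    fun ξ hξ u hu => ?_⟩
  · exact ((Complex.continuous_ofReal.comp (by fun_prop)).mul
      (hdot.comp (continuous_const.prodMk hPu))).add
      ((Complex.continuous_ofReal.comp (by fun_prop)).mul
        (hdot.comp (continuous_const.prodMk hPu)))
  · simp only [Matrix.mulVec_neg, dotProduct_neg]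
    ring
  · have h1 : ((P ξ).map star).mulVec (star u) = star ((P ξ).mulVec u) := by
      funext i
      simp [Matrix.mulVec, dotProduct]
    have h2 (a b : Fin (n + 1) → ℂ) : star (a ⬝ᵥ b) = star a ⬝ᵥ star b := by simp [dotProduct]
    have h3 (x : ℝ) : star (x : ℂ) = x := Complex.conj_ofReal x
    simp only [hPτ, hcτ, h1, star_add, star_mul', h2, star_star, h3]
    rw [sub_neg_eq_add, ← sub_eq_add_neg, add_comm]
  · obtain ⟨h, hmk⟩ := hPm ξ u hu
    rcases hq ξ hξ with h1 | h1
    · have hc1 : c ξ = 1 := by simp only [c, h1, height_self]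
      rw [h1, ← hw] at hmk
      obtain ⟨a, ha⟩ := CP.mk_eq_iff.1 hmk.symm
      have ha0 := ne_zero_of_eq_smul h ha
      simp only at ha
      simp only [hc1, ha, dotProduct_smul, smul_eq_mul]
      simpa using ⟨ha0, dotProduct_star_self_ne_zero w.2⟩
    · have hc1 : c ξ = -1 := by simp only [c, h1, height_deck, height_self]
      rw [h1, show (deck q).1 = cpConj n q.1 from rfl, ← hw, cpConj_mk] at hmk
      obtain ⟨a, ha⟩ := CP.mk_eq_iff.1 hmk.symm
      have ha0 := ne_zero_of_eq_smul h ha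
      simp only at ha
      simp only [hc1, ha, dotProduct_smul, smul_eq_mul]
      have := dotProduct_star_self_ne_zero w.2
      rw [dotProduct_comm] at this
      norm_num
      exact ⟨ha0, this⟩

end Labels

section Coordinates

/-- Spheres include isometrically into spheres of larger dimension. -/
lemma exists_linearIsometry_euclidean {a b : ℕ} (h : a ≤ b) :
    Nonempty (EuclideanSpace ℝ (Fin a) →ₗᵢ[ℝ] EuclideanSpace ℝ (Fin b)) := by
  let v := EuclideanSpace.basisFun (Fin a) ℝ
  let w := EuclideanSpace.basisFun (Fin b) ℝ
  let f := v.toBasis.constr ℝ fun i => w (Fin.castLE h i)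
  refine ⟨f.isometryOfOrthonormal (v := v.toBasis) (by simp) ?_⟩
  have : f ∘ v.toBasis = fun i => w (Fin.castLE h i) := by
    funext i
    exact v.toBasis.constr_basis ℝ _ i
  rw [this]
  exact w.orthonormal.comp _ (Fin.castLE_injective h)

/-- The line spanned by a vector. -/
noncomputable def lineOf {n : ℕ} (w : Fin (n + 1) → ℂ) : CP n :=
  open Classical in if h : w ≠ 0 then CP.mk ⟨w, h⟩ else CP.mk ⟨fun _ => 1, fun h => by
    simpa using congrFun h 0⟩

lemma lineOf_of_ne {n : ℕ} {w : Fin (n + 1) → ℂ} (h : w ≠ 0) : lineOf w = CP.mk ⟨w, h⟩ := dif_pos h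

lemma continuousOn_lineOf {n : ℕ} : ContinuousOn (lineOf (n := n)) {w | w ≠ 0} := by
  rw [continuousOn_iff_continuous_domRestrict]
  exact (CP.continuous_mk (n := n)).congr fun w => (lineOf_of_ne w.2).symm

lemma lineOf_neg {n : ℕ} (w : Fin (n + 1) → ℂ) : lineOf (-w) = lineOf w := by
  by_cases h : w = 0
  · simp [h]
  · rw [lineOf_of_ne h, lineOf_of_ne (neg_ne_zero.2 h)]
    exact CP.mk_eq_iff.2 ⟨-1, by simp⟩

lemma lineOf_star {n : ℕ} {w : Fin (n + 1) → ℂ} (h : w ≠ 0) :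
    lineOf (star w) = cpConj n (lineOf w) := by
  rw [lineOf_of_ne h, lineOf_of_ne (star_ne_zero' h), cpConj_mk]

/-- The direction of a vector. -/
noncomputable def dirOf {k : ℕ} (x : EuclideanSpace ℝ (Fin (k + 1))) : Sph k :=
  open Classical in if h : x ≠ 0 then ⟨‖x‖⁻¹ • x, by simp [norm_smul, h]⟩
    else ⟨EuclideanSpace.single 0 1, by simp⟩

lemma coe_dirOf {k : ℕ} {x : EuclideanSpace ℝ (Fin (k + 1))} (h : x ≠ 0) :
    (dirOf x : EuclideanSpace ℝ (Fin (k + 1))) = ‖x‖⁻¹ • x := by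
  rw [dirOf, dif_pos h]

lemma norm_smul_dirOf {k : ℕ} (x : EuclideanSpace ℝ (Fin (k + 1))) :
    ‖x‖ • (dirOf x : EuclideanSpace ℝ (Fin (k + 1))) = x := by
  by_cases h : x = 0
  · simp [h]
  · rw [coe_dirOf h, smul_smul, mul_inv_cancel₀ (norm_ne_zero_iff.2 h), one_smul]

lemma continuousOn_dirOf {k : ℕ} : ContinuousOn (dirOf (k := k)) {x | x ≠ 0} := by
  rw [Topology.IsInducing.subtypeVal.continuousOn_iff]
  have : ContinuousOn (fun x : EuclideanSpace ℝ (Fin (k + 1)) => ‖x‖⁻¹ • x) {x | x ≠ 0} :=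
    (continuousOn_id.norm.inv₀ fun x hx => norm_ne_zero_iff.2 hx).smul continuousOn_id
  exact this.congr fun x hx => coe_dirOf hx

lemma dirOf_neg {k : ℕ} {x : EuclideanSpace ℝ (Fin (k + 1))} (h : x ≠ 0) :
    dirOf (-x) = negSph k (dirOf x) := by
  ext1
  rw [coe_negSph, coe_dirOf h, coe_dirOf (neg_ne_zero.2 h), norm_neg, smul_neg]

/-- A vector of `ℝ^{2n+1}` as a vector of `ℂ^{n+1}` whose last coordinate is real. -/
noncomputable def toComplex {n : ℕ} (v : Fin (2 * n + 1) → ℝ) (j : Fin (n + 1)) : ℂ :=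
  v ⟨n + j, by omega⟩ + (if h : (j : ℕ) < n then v ⟨j, by omega⟩ else 0 : ℝ) * Complex.I

/-- The signs of the coordinates of `ℝ^{2n+1}` under complex conjugation. -/
def conjSign (n : ℕ) (i : ℕ) : ℝ := if i < n then -1 else 1

variable {n : ℕ}

lemma isSign_conjSign : IsSign (conjSign n) := by
  intro i
  unfold conjSign
  split_ifs <;> simp

lemma continuous_toComplex : Continuous (toComplex (n := n)) := by
  refine continuous_pi fun j => ?_
  unfold toComplex
  split_ifs <;> fun_prop

lemma toComplex_neg (v : Fin (2 * n + 1) → ℝ) : toComplex (-v) = -toComplex v := by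
  funext j
  simp only [toComplex, Pi.neg_apply]
  split_ifs <;> push_cast <;> ring

lemma toComplex_flip (v : Fin (2 * n + 1) → ℝ) :
    toComplex (flip (conjSign n) v) = star (toComplex v) := by
  funext j
  have h : ¬ n + (j : ℕ) < n := by omega
  simp only [toComplex, flip, conjSign, Pi.star_apply, h, if_false]
  split_ifs <;> simp

lemma toComplex_ne_zero {v : Fin (2 * n + 1) → ℝ} (hv : v ≠ 0) : toComplex v ≠ 0 := by
  intro h
  refine hv (funext fun i => ?_)
  by_cases hi : (i : ℕ) < n
  · have := congrArg Complex.im (congrFun h ⟨i, by omega⟩)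
    simpa [toComplex, hi] using this
  · have := congrArg Complex.re (congrFun h ⟨i - n, by omega⟩)
    have hi' : n + (i - n : ℕ) = i := by omega
    simpa [toComplex, hi'] using this

variable {r b : ℕ} {m : Fin r → ℕ}

/-- The blocks of a vector of `ℝ^{b+1}`. -/
noncomputable def block (e : (Σ i, Fin (m i + 1)) ≃ Fin (b + 1)) (x : Fin (b + 1) → ℝ)
    (i : Fin r) : EuclideanSpace ℝ (Fin (m i + 1)) :=
  WithLp.toLp 2 fun j => x (e ⟨i, j⟩)

variable (e : (Σ i, Fin (m i + 1)) ≃ Fin (b + 1))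

lemma continuous_block (i : Fin r) : Continuous fun x => block e x i := by
  unfold block
  fun_prop

lemma block_neg (x : Fin (b + 1) → ℝ) (i : Fin r) : block e (-x) i = -block e x i := rfl

lemma eq_zero_of_block {x : Fin (b + 1) → ℝ} (h : ∀ i, block e x i = 0) : x = 0 := by
  funext k
  obtain ⟨⟨i, j⟩, rfl⟩ := e.surjective k
  exact congrArg (fun y : EuclideanSpace ℝ (Fin (m i + 1)) => y j) (h i)

/-- The parametrization of the double cover by a product of two spheres, defined off the
vectors with a vanishing block. -/
noncomputable def toCover (ω : (Fin (2 * n + 1) → ℝ) × (Fin (b + 1) → ℝ)) : DoubleCover n r m :=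
  (lineOf (toComplex ω.1), fun i => dirOf (block e ω.2 i))

/-- The vectors all of whose blocks are nonzero. -/
def regular (n : ℕ) : Set ((Fin (2 * n + 1) → ℝ) × (Fin (b + 1) → ℝ)) :=
  {ω | toComplex ω.1 ≠ 0 ∧ ∀ i, block e ω.2 i ≠ 0}

lemma isOpen_regular : IsOpen (regular e n) := by
  refine IsOpen.and ?_ ?_
  · exact isOpen_ne_fun (continuous_toComplex.comp continuous_fst) continuous_const
  · simp only [ofPred_forall]
    exact isOpen_iInter_of_finite fun i =>
      isOpen_ne_fun ((continuous_block e i).comp continuous_snd) continuous_const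

lemma continuousOn_toCover : ContinuousOn (toCover (n := n) e) (regular e n) :=
  (continuousOn_lineOf.comp (continuous_toComplex.comp continuous_fst).continuousOn
    fun _ h => h.1).prodMk (continuousOn_pi.2 fun i => continuousOn_dirOf.comp
      ((continuous_block e i).comp continuous_snd).continuousOn fun _ h => h.2 i)

lemma toCover_negFst (ω : (Fin (2 * n + 1) → ℝ) × (Fin (b + 1) → ℝ)) :
    toCover e (negFst ω) = toCover e ω := by
  simp only [toCover, negFst, toComplex_neg, lineOf_neg]

lemma toCover_flipNeg {ω : (Fin (2 * n + 1) → ℝ) × (Fin (b + 1) → ℝ)} (h : ω ∈ regular e n) :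
    toCover e (flipNeg (conjSign n) ω) = deck (toCover e ω) := by
  simp only [toCover, flipNeg, toComplex_flip, lineOf_star h.1, deck, block_neg]
  congr 1
  funext i
  exact dirOf_neg (h.2 i)

lemma negFst_mem_regular {ω : (Fin (2 * n + 1) → ℝ) × (Fin (b + 1) → ℝ)} :
    negFst ω ∈ regular e n ↔ ω ∈ regular e n := by
  simp [regular, negFst, toComplex_neg]

lemma flipNeg_mem_regular {ω : (Fin (2 * n + 1) → ℝ) × (Fin (b + 1) → ℝ)} :
    flipNeg (conjSign n) ω ∈ regular e n ↔ ω ∈ regular e n := by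
  simp [regular, flipNeg, toComplex_flip, block_neg]

lemma mk_toComplex {ω : (Fin (2 * n + 1) → ℝ) × (Fin (b + 1) → ℝ)} (h : ω ∈ regular e n) :
    CP.mk ⟨toComplex ω.1, h.1⟩ = (toCover e ω).1 := (lineOf_of_ne h.1).symm

/-- The deviation from having all blocks of the same norm. -/
noncomputable def imbalance (i₀ : Fin r) (x : Fin (b + 1) → ℝ) : ℝ :=
  ∑ i, |‖block e x i‖ - ‖block e x i₀‖|

lemma continuous_imbalance (i₀ : Fin r) : Continuous (imbalance e i₀) := by
  have := continuous_block e
  unfold imbalance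
  exact continuous_finsetSum _ fun i _ => ((this i).norm.sub (this i₀).norm).abs

lemma imbalance_neg (i₀ : Fin r) (x : Fin (b + 1) → ℝ) : imbalance e i₀ (-x) = imbalance e i₀ x := by
  simp only [imbalance, block_neg, norm_neg]

lemma imbalance_eq_zero_iff (i₀ : Fin r) (x : Fin (b + 1) → ℝ) :
    imbalance e i₀ x = 0 ↔ ∀ i, ‖block e x i‖ = ‖block e x i₀‖ := by
  rw [imbalance, Finset.sum_eq_zero_iff_of_nonneg fun _ _ => abs_nonneg _]
  simp [sub_eq_zero]

lemma mem_regular_of_imbalance {i₀ : Fin r} {ω : (Fin (2 * n + 1) → ℝ) × (Fin (b + 1) → ℝ)}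
    (hω : ω ∈ sphProd (2 * n) b) (h : imbalance e i₀ ω.2 = 0) : ω ∈ regular e n := by
  rw [imbalance_eq_zero_iff] at h
  refine ⟨toComplex_ne_zero ?_, fun i hi => ?_⟩
  · intro h0
    have := hω.1
    simp [h0] at this
  · have h0 (j) : block e ω.2 j = 0 := by
      rw [← norm_eq_zero, h j, ← h i, hi, norm_zero]
    have := hω.2
    simp [eq_zero_of_block e h0] at this

lemma exists_time (i₀ : Fin r) : ∃ t : (Fin (b + 1) → ℝ) → ℝ, Continuous t ∧
    (∀ x, t (-x) = t x) ∧ (∀ x, imbalance e i₀ x = 0 → t x = 1) ∧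
    ∀ ω ∈ sphProd (2 * n) b, ω ∉ regular e n → ∀ᶠ x in nhds ω.2, t x = 0 := by
  have hd := continuous_imbalance e i₀
  have hK := (isCompact_sphProd (a := 2 * n) (b := b)).diff (isOpen_regular (n := n) e)
  have hg : Continuous fun ω : (Fin (2 * n + 1) → ℝ) × (Fin (b + 1) → ℝ) => imbalance e i₀ ω.2 :=
    hd.comp continuous_snd
  have hpos : ∀ ω ∈ sphProd (2 * n) b \ regular e n, 0 < imbalance e i₀ ω.2 := fun ω hω =>
    (Finset.sum_nonneg fun _ _ => abs_nonneg _).lt_of_ne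
      fun h0 => hω.2 (mem_regular_of_imbalance e hω.1 h0.symm)
  obtain ⟨δ, hδ, h⟩ := hK.exists_forall_le' hg.continuousOn hpos
  refine ⟨fun x => max 0 (1 - 2 / δ * imbalance e i₀ x), by fun_prop, fun x => ?_, fun x hx => ?_,
    fun ω hω hωr => ?_⟩
  · simp only [imbalance_neg]
  · simp [hx]
  · have h1 : δ / 2 < imbalance e i₀ ω.2 := by linarith [h ω ⟨hω, hωr⟩]
    filter_upwards [hd.continuousAt.eventually (lt_mem_nhds h1)] with x hx
    refine max_eq_left ?_
    have : 1 = 2 / δ * (δ / 2) := by field_simp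
    have h2 : 2 / δ * (δ / 2) ≤ 2 / δ * imbalance e i₀ x := by gcongr
    linarith

end Coordinates

section LowerBound

variable {n r b : ℕ} {m : Fin r → ℕ}

lemma exists_sphere_function (e : (Σ i, Fin (m i + 1)) ≃ Fin (b + 1))
    {t : (Fin (b + 1) → ℝ) → ℝ} (ht : Continuous t) (htn : ∀ x, t (-x) = t x)
    (ht0 : ∀ ω ∈ sphProd (2 * n) b, ω ∉ regular e n → ∀ᶠ x in nhds ω.2, t x = 0)
    {Γ : ℝ × DoubleCover n r m → DoubleCover n r m} (hΓ : Continuous Γ)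
    (hΓ0 : ∀ ξ, Γ (0, ξ) = ξ) (hΓτ : ∀ t ξ, Γ (t, deck ξ) = deck (Γ (t, ξ)))
    (V : Set (DoubleCover n r m)) (q : DoubleCover n r m)
    (hq : ∀ ξ ∈ V, Γ (1, ξ) = q ∨ Γ (1, ξ) = deck q) {i₀ i : Fin r} (hm : m i₀ ≤ m i) :
    ∃ F : (Fin (2 * n + 1) → ℝ) × (Fin (b + 1) → ℝ) → EuclideanSpace ℝ (Fin (m i + 1)),
      (∀ ω ∈ sphProd (2 * n) b, ContinuousAt F ω) ∧
      (∀ ω, F (negFst ω) = F ω) ∧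
      (∀ ω ∈ sphProd (2 * n) b, F (flipNeg (conjSign n) ω) = -F ω) ∧
      (∀ ω, ‖block e ω.2 i‖ ≠ ‖block e ω.2 i₀‖ → F ω ≠ 0) ∧
      ∀ ω ∈ regular e n, t ω.2 = 1 → toCover e ω ∈ V → F ω ≠ 0 := by
  obtain ⟨s⟩ := exists_linearIsometry_euclidean (Nat.succ_le_succ hm)
  obtain ⟨η, hη, hηq⟩ : ∃ η : ℝ, |η| = 1 ∧
      (q.2 i : EuclideanSpace ℝ (Fin (m i + 1))) + η • s (q.2 i₀) ≠ 0 := by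
    by_cases h : (q.2 i : EuclideanSpace ℝ (Fin (m i + 1))) + s (q.2 i₀) = 0
    · refine ⟨-1, by simp, fun h' => ?_⟩
      have h2 : (2 : ℝ) • (q.2 i : EuclideanSpace ℝ (Fin (m i + 1))) = 0 := by
        have h'' : (2 : ℝ) • (q.2 i : EuclideanSpace ℝ (Fin (m i + 1))) =
          (q.2 i + s (q.2 i₀)) + (q.2 i + (-1 : ℝ) • s (q.2 i₀)) := by module
        rw [h'', h, h', add_zero]
      have h3 := norm_coe_sph (q.2 i)
      rw [(smul_eq_zero.1 h2).resolve_left two_ne_zero, norm_zero] at h3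
      exact zero_ne_one h3
    · exact ⟨1, by simp, by simpa using h⟩
  let A : (Fin (2 * n + 1) → ℝ) × (Fin (b + 1) → ℝ) → ∀ j, Sph (m j) := fun ω =>
    (Γ (t ω.2, toCover e ω)).2
  let F : (Fin (2 * n + 1) → ℝ) × (Fin (b + 1) → ℝ) → EuclideanSpace ℝ (Fin (m i + 1)) := fun ω =>
    ‖block e ω.2 i‖ • (A ω i : EuclideanSpace ℝ (Fin (m i + 1))) +
      η • ‖block e ω.2 i₀‖ • s (A ω i₀)
  have hF0 (ω) (h : t ω.2 = 0) : F ω = block e ω.2 i + η • s (block e ω.2 i₀) := by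
    simp only [F, A, h, hΓ0, toCover, norm_smul_dirOf, ← map_smul]
  have hblock := continuous_block e
  have hne (ω) (h : ‖block e ω.2 i‖ ≠ ‖block e ω.2 i₀‖) : F ω ≠ 0 := by
    intro h0
    refine h ?_
    have h1 := congrArg norm (eq_neg_of_add_eq_zero_left h0)
    rw [norm_neg, norm_smul, norm_smul, norm_smul, s.norm_map, norm_coe_sph, norm_coe_sph,
      norm_norm, norm_norm, Real.norm_eq_abs, hη, one_mul, mul_one, mul_one] at h1
    exact h1
  refine ⟨F, fun ω hω => ?_, fun ω => ?_, fun ω hω => ?_, hne, fun ω hω h1 hV => ?_⟩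
  · by_cases h : ω ∈ regular e n
    · refine ContinuousOn.continuousAt ?_ ((isOpen_regular e).mem_nhds h)
      have hA : ContinuousOn A (regular e n) :=
        (continuous_snd.comp hΓ).comp_continuousOn
          ((ht.comp continuous_snd).continuousOn.prodMk (continuousOn_toCover e))
      have hAj (j) : ContinuousOn (fun ω => (A ω j : EuclideanSpace ℝ (Fin (m j + 1))))
          (regular e n) :=
        continuous_subtype_val.comp_continuousOn (continuousOn_pi.1 hA j)
      have hb (j) : Continuous fun ω : (Fin (2 * n + 1) → ℝ) × (Fin (b + 1) → ℝ) =>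
          ‖block e ω.2 j‖ := ((hblock j).comp continuous_snd).norm
      exact ((hb i).continuousOn.smul (hAj i)).add
        (((hb i₀).continuousOn.smul (s.continuous.comp_continuousOn (hAj i₀))).const_smul η)
    · have hc : Continuous fun ω : (Fin (2 * n + 1) → ℝ) × (Fin (b + 1) → ℝ) =>
          block e ω.2 i + η • s (block e ω.2 i₀) :=
        ((hblock i).comp continuous_snd).add
          ((s.continuous.comp ((hblock i₀).comp continuous_snd)).const_smul η)
      refine hc.continuousAt.congr ?_
      filter_upwards [continuous_snd.continuousAt.eventually (ht0 ω hω h)] with x hx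
      exact (hF0 x hx).symm
  · simp only [F, A, toCover_negFst]
    rfl
  · by_cases h : ω ∈ regular e n
    · have hA (j) : A (flipNeg (conjSign n) ω) j = negSph (m j) (A ω j) := by
        simp only [A, toCover_flipNeg e h, hΓτ]
        simp only [flipNeg, htn]
        rfl
      simp only [F, hA, coe_negSph, map_neg, smul_neg, neg_add]
      simp only [flipNeg, block_neg, norm_neg]
    · have h0 := (ht0 ω hω h).self_of_nhds
      have h0' : t (flipNeg (conjSign n) ω).2 = 0 := by rw [flipNeg, htn, h0]
      rw [hF0 _ h0, hF0 _ h0']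
      simp only [flipNeg, block_neg, map_neg, smul_neg, neg_add]
  · by_cases h : ‖block e ω.2 i‖ = ‖block e ω.2 i₀‖
    · have hn : ‖block e ω.2 i₀‖ ≠ 0 := norm_ne_zero_iff.2 (hω.2 i₀)
      rcases hq _ hV with h2 | h2
      · have : F ω = ‖block e ω.2 i₀‖ • ((q.2 i : EuclideanSpace ℝ (Fin (m i + 1))) +
            η • s (q.2 i₀)) := by
          simp only [F, A, h1, h2, h, smul_add, smul_comm η]
        rw [this]
        exact smul_ne_zero hn hηq
      · have : F ω = -(‖block e ω.2 i₀‖ • ((q.2 i : EuclideanSpace ℝ (Fin (m i + 1))) +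
            η • s (q.2 i₀))) := by
          simp only [F, A, h1, h2, h, smul_add, smul_comm η, deck, coe_negSph, map_neg, smul_neg,
            neg_add]
        rw [this]
        exact neg_ne_zero.2 (smul_ne_zero hn hηq)
    · exact hne ω h

lemma le_of_hasCatCover (i₀ : Fin r) (hm : ∀ i, m i₀ ≤ m i) {k : ℕ}
    (hk : HasCatCover (CPGPP n r m) k) : n + m i₀ + r ≤ k := by
  classical
  by_contra! hlt
  have hr : 0 < r := i₀.pos
  obtain ⟨V, q, Γ, hV, hVτ, hVc, hΓ, hΓ0, hΓτ, hΓ1⟩ := exists_equivariant_deformation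
    (isOpenQuotientMap_coverProj (n := n) (m := m)) continuous_deck deck_deck (deck_ne hr)
    (fun _ _ => coverProj_eq_iff) hk
  let L := Fin (m i₀) ⊕ {i // i ≠ i₀} ⊕ Fin n
  have hcard : Fintype.card {i // i ≠ i₀} = r - 1 := by
    simp [Fintype.card_subtype_compl]
  have hL : Fintype.card (Fin k) ≤ Fintype.card L := by
    simp only [L, Fintype.card_sum, Fintype.card_fin, hcard]
    omega
  obtain ⟨f⟩ := Function.Embedding.nonempty_of_card_le hL
  have : Nonempty (Fin k) :=
    ⟨(hVc (lineOf 0, fun i => dirOf 0)).choose⟩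
  let lab : L → Fin k := Function.invFun f
  have hlab : Function.Surjective lab := Function.invFun_surjective f.injective
  let κ := Fin (m i₀) ⊕ Σ i : {i // i ≠ i₀}, Fin (m i + 1)
  have hsum : Fintype.card (Σ i, Fin (m i + 1)) = Fintype.card κ + 1 := by
    simp only [κ, Fintype.card_sum, Fintype.card_sigma, Fintype.card_fin]
    rw [Fintype.sum_eq_add_sum_subtype_ne _ i₀]
    omega
  let b := Fintype.card κ
  let e : (Σ i, Fin (m i + 1)) ≃ Fin (b + 1) := Fintype.equivFinOfCardEq hsum
  obtain ⟨t, ht, htn, ht1, ht0⟩ := exists_time (n := n) e i₀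
  choose G hG hGn hGτ hGV using fun l => exists_line_function i₀ (hΓ l) (hΓ0 l) (hΓτ l) (V l) (q l)
    (hΓ1 l)
  choose F hF hFn hFτ hFne hFV using fun (l : Fin k) (i : Fin r) =>
    exists_sphere_function (i₀ := i₀) e ht htn ht0 (hΓ l) (hΓ0 l) (hΓτ l) (V l) (q l) (hΓ1 l) (hm i)
  let Ω := regular e n
  let g (j : Fin n) (ω : (Fin (2 * n + 1) → ℝ) × (Fin (b + 1) → ℝ)) : ℂ :=
    Ω.indicator (fun ω => G (lab (.inr (.inr j))) (toCover e ω, toComplex ω.1)) ω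
  let h (j : Fin (m i₀)) (ω : (Fin (2 * n + 1) → ℝ) × (Fin (b + 1) → ℝ)) : ℝ :=
    Ω.indicator (fun ω => height i₀ (q (lab (.inl j))) (Γ (lab (.inl j)) (1, toCover e ω))) ω
  have hgn (j ω) : g j (negFst ω) = -g j ω := by
    by_cases hω : ω ∈ Ω
    · have hω' : negFst ω ∈ Ω := (negFst_mem_regular e).2 hω
      simp only [g, indicator_of_mem hω, indicator_of_mem hω', toCover_negFst]
      simp only [negFst, toComplex_neg, hGn]
    · have hω' : negFst ω ∉ Ω := mt (negFst_mem_regular e).1 hω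
      simp only [g, indicator_of_notMem hω, indicator_of_notMem hω', neg_zero]
  have hgτ (j ω) : g j (flipNeg (conjSign n) ω) = star (g j ω) := by
    by_cases hω : ω ∈ Ω
    · have hω' : flipNeg (conjSign n) ω ∈ Ω := (flipNeg_mem_regular e).2 hω
      simp only [g, indicator_of_mem hω, indicator_of_mem hω', toCover_flipNeg e hω]
      simp only [flipNeg, toComplex_flip, hGτ]
    · have hω' : flipNeg (conjSign n) ω ∉ Ω := mt (flipNeg_mem_regular e).1 hω
      simp only [g, indicator_of_notMem hω, indicator_of_notMem hω', star_zero]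
  have hhn (j ω) : h j (negFst ω) = h j ω := by
    by_cases hω : ω ∈ Ω
    · have hω' : negFst ω ∈ Ω := (negFst_mem_regular e).2 hω
      simp only [h, indicator_of_mem hω, indicator_of_mem hω', toCover_negFst]
    · have hω' : negFst ω ∉ Ω := mt (negFst_mem_regular e).1 hω
      simp only [h, indicator_of_notMem hω, indicator_of_notMem hω']
  have hhτ (j ω) : h j (flipNeg (conjSign n) ω) = -h j ω := by
    by_cases hω : ω ∈ Ω
    · have hω' : flipNeg (conjSign n) ω ∈ Ω := (flipNeg_mem_regular e).2 hω
      simp only [h, indicator_of_mem hω, indicator_of_mem hω', toCover_flipNeg e hω, hΓτ,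
        height_deck]
    · have hω' : flipNeg (conjSign n) ω ∉ Ω := mt (flipNeg_mem_regular e).1 hω
      simp only [h, indicator_of_notMem hω, indicator_of_notMem hω', neg_zero]
  let φ : Fin n ⊕ Fin n → (Fin (2 * n + 1) → ℝ) × (Fin (b + 1) → ℝ) → ℝ :=
    Sum.elim (fun j ω => (g j ω).re) (fun j ω => (g j ω).im)
  let ψ : κ → (Fin (2 * n + 1) → ℝ) × (Fin (b + 1) → ℝ) → ℝ :=
    Sum.elim h fun x ω => F (lab (.inr (.inl x.1))) x.1 ω x.2
  obtain ⟨u, hu, hφ0, hψ0⟩ := exists_zero_or_discontinuity (a := 2 * n) (b := b) (ι := Fin n ⊕ Fin n)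
    (κ := κ) (by simp [two_mul]) rfl (isSign_conjSign (n := n)) (by simp [conjSign]; omega) φ ψ
    (by
      rintro (j | j) ω - <;> simp [φ, hgn])
    (by
      rintro (j | j)
      · exact Or.inl fun ω _ => by simp [φ, hgτ]
      · exact Or.inr fun ω _ => by simp [φ, hgτ])
    (by
      rintro (j | j) ω -
      · exact hhn j ω
      · simp [ψ, hFn])
    (by
      rintro (j | j) ω hω
      · exact hhτ j ω
      · simp [ψ, hFτ _ _ _ hω])
  have hF0 (i : {i // i ≠ i₀}) : F (lab (.inr (.inl i))) i u = 0 := by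
    ext j
    refine hψ0 (.inr ⟨i, j⟩) (ContinuousAt.continuousWithinAt ?_)
    exact ((EuclideanSpace.proj (𝕜 := ℝ) j).continuous.continuousAt).comp
      (hF (lab (.inr (.inl i))) i u hu)
  have himb : imbalance e i₀ u.2 = 0 := by
    rw [imbalance_eq_zero_iff]
    intro i
    by_cases hi : i = i₀
    · rw [hi]
    · by_contra hne
      exact hFne _ _ _ hne (hF0 ⟨i, hi⟩)
  have huΩ : u ∈ Ω := mem_regular_of_imbalance e hu himb
  have hΩ : Ω ∈ nhds u := (isOpen_regular e).mem_nhds huΩ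
  have hcov : ContinuousAt (toCover e) u := (continuousOn_toCover e).continuousAt hΩ
  obtain ⟨l, hl⟩ := hVc (toCover e u)
  obtain ⟨x, rfl⟩ := hlab l
  rcases x with j | i | j
  · have hc : ContinuousAt (h j) u := by
      refine ContinuousAt.congr (f := fun ω =>
        height i₀ (q (lab (.inl j))) (Γ (lab (.inl j)) (1, toCover e ω))) ?_ ?_
      · exact ((continuous_height _ _).comp (hΓ _)).continuousAt.comp
          (continuousAt_const.prodMk hcov)
      · filter_upwards [hΩ] with ω hω
        simp only [h, indicator_of_mem hω]
    have h0 : h j u = 0 := hψ0 (.inl j) hc.continuousWithinAt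
    simp only [h, indicator_of_mem huΩ] at h0
    rcases hΓ1 _ _ hl with h1 | h1 <;> simp [h1, height_deck, height_self] at h0
  · exact hFV _ i u huΩ (ht1 _ himb) hl (hF0 i)
  · have hc : ContinuousAt (g j) u := by
      refine ContinuousAt.congr (f := fun ω =>
        G (lab (.inr (.inr j))) (toCover e ω, toComplex ω.1)) ?_ ?_
      · exact (hG _).continuousAt.comp
          (hcov.prodMk (continuous_toComplex.comp continuous_fst).continuousAt)
      · filter_upwards [hΩ] with ω hω
        simp only [g, indicator_of_mem hω]
    have hre : (g j u).re = 0 :=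
      hφ0 (.inl j) (Complex.continuous_re.continuousAt.comp hc).continuousWithinAt
    have him : (g j u).im = 0 :=
      hφ0 (.inr j) (Complex.continuous_im.continuousAt.comp hc).continuousWithinAt
    have h0 : g j u = 0 := Complex.ext hre him
    simp only [g, indicator_of_mem huΩ] at h0
    exact hGV _ _ hl ⟨toComplex u.1, huΩ.1⟩ (mk_toComplex e huΩ) h0

end LowerBound

section CategoricalCover

variable {X : Type*} [TopologicalSpace X]

/-- The inclusion of `U` in the ambient space is null-homotopic. -/
def Inessential (U : Set X) : Prop :=
  (⟨Subtype.val, continuous_subtype_val⟩ : C(U, X)).Nullhomotopic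

lemma Inessential.mono {U V : Set X} (hV : Inessential V) (h : U ⊆ V) : Inessential U :=
  ContinuousMap.Nullhomotopic.comp_left hV (ContinuousMap.inclusion h)

lemma isOpenQuotientMap_restrictPreimage {Y : Type*} [TopologicalSpace Y] {p : Y → X}
    (hp : IsOpenQuotientMap p) (U : Set X) : IsOpenQuotientMap (U.restrictPreimage p) :=
  ⟨U.restrictPreimage_surjective hp.surjective, hp.continuous.restrictPreimage,
    hp.isOpenMap.restrictPreimage U⟩

lemma inessential_of_lift {Y : Type*} [TopologicalSpace Y] {p : Y → X} (hp : IsOpenQuotientMap p)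
    {U : Set X} {Φ : ℝ × Y → X} (hΦ : ContinuousOn Φ {q | p q.2 ∈ U}) (x₀ : X)
    (hinv : ∀ t ξ ξ', p ξ ∈ U → p ξ = p ξ' → Φ (t, ξ) = Φ (t, ξ'))
    (h0 : ∀ ξ, p ξ ∈ U → Φ (0, ξ) = p ξ) (h1 : ∀ ξ, p ξ ∈ U → Φ (1, ξ) = x₀) :
    Inessential U := by
  have hσ (x : X) : p (Function.surjInv hp.surjective x) = x := Function.surjInv_eq hp.surjective x
  have hF : Continuous fun q : ℝ × U => Φ (q.1, Function.surjInv hp.surjective q.2) := by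
    rw [(IsOpenQuotientMap.prodMap IsOpenQuotientMap.id
      (isOpenQuotientMap_restrictPreimage hp U)).isQuotientMap.continuous_iff]
    have h : Continuous fun q : ℝ × (p ⁻¹' U) => Φ (q.1, (q.2 : Y)) :=
      hΦ.comp_continuous (by fun_prop) fun q => q.2.2
    convert! h using 1
    funext q
    refine hinv _ _ _ ?_ ?_
    · rw [hσ]; exact q.2.2
    · rw [hσ]; rfl
  refine ⟨x₀, ⟨⟨⟨fun q => Φ ((q.1 : ℝ), Function.surjInv hp.surjective q.2), ?_⟩, ?_, ?_⟩⟩⟩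
  · exact hF.comp ((continuous_subtype_val.comp continuous_fst).prodMk continuous_snd)
  · intro u
    change Φ (0, _) = u
    rw [h0, hσ]
    rw [hσ]; exact u.2
  · intro u
    change Φ (1, _) = x₀
    rw [h1]
    rw [hσ]; exact u.2

lemma inessential_iUnion [PathConnectedSpace X] {ι : Type*} {U : ι → Set X}
    (hU : ∀ i, IsOpen (U i)) (hd : ∀ i j, i ≠ j → Disjoint (U i) (U j))
    (hn : ∀ i, Inessential (U i)) : Inessential (⋃ i, U i) := by
  obtain ⟨x₀⟩ : Nonempty X := inferInstance
  have hH (i : ι) : (⟨Subtype.val, continuous_subtype_val⟩ : C(U i, X)).Homotopic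
      (ContinuousMap.const _ x₀) := by
    obtain ⟨y, hy⟩ := hn i
    refine hy.trans ?_
    obtain ⟨γ⟩ := PathConnectedSpace.joined y x₀
    exact ⟨⟨⟨fun q => γ q.1, by fun_prop⟩, by simp, by simp⟩⟩
  let H (i : ι) := (hH i).some
  let S (i : ι) : Set (unitInterval × (⋃ i, U i : Set X)) := {q | (q.2 : X) ∈ U i}
  have hS (i : ι) : IsOpen (S i) := (hU i).preimage (by fun_prop)
  let φ (i : ι) : C(S i, X) :=
    ⟨fun q => H i (q.1.1, ⟨q.1.2, q.2⟩), by fun_prop⟩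
  have hφ : ∀ (i j : ι) (x : _) (hxi : x ∈ S i) (hxj : x ∈ S j), φ i ⟨x, hxi⟩ = φ j ⟨x, hxj⟩ := by
    intro i j x hxi hxj
    by_cases hij : i = j
    · subst hij; rfl
    · exact absurd hxj (Set.disjoint_left.1 (hd i j hij) hxi)
  have hcov : ∀ x, ∃ i, S i ∈ nhds x := by
    intro x
    obtain ⟨i, hi⟩ := mem_iUnion.1 x.2.2
    exact ⟨i, (hS i).mem_nhds hi⟩
  have hF (i : ι) (t : unitInterval) (u : (⋃ i, U i : Set X)) (hu : (u : X) ∈ U i) :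
      ContinuousMap.liftCover S φ hφ hcov (t, u) = H i (t, ⟨u, hu⟩) :=
    ContinuousMap.liftCover_coe (S := S) (φ := φ) (hφ := hφ) (hS := hcov) (i := i) ⟨(t, u), hu⟩
  refine ⟨x₀, ⟨⟨ContinuousMap.liftCover S φ hφ hcov, ?_, ?_⟩⟩⟩
  · intro u
    obtain ⟨i, hi⟩ := mem_iUnion.1 u.2
    exact (hF i 0 u hi).trans ((H i).apply_zero _)
  · intro u
    obtain ⟨i, hi⟩ := mem_iUnion.1 u.2
    exact (hF i 1 u hi).trans ((H i).apply_one _)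

lemma hasCatCover_of_weights [PathConnectedSpace X] {ι : Type*} [Finite ι] (rank : ι → ℕ)
    {u : ι → X → ℝ} (hu : ∀ i, Continuous (u i)) {k : ℕ}
    (hcov : ∀ x, ∃ i, rank i < k ∧ 0 < u i x ∧ ∀ j, j ≠ i → rank j = rank i → u j x = 0)
    (hn : ∀ i, Inessential {x | 0 < u i x}) : HasCatCover X k := by
  let O (i : ι) : Set X := {x | 0 < u i x} ∩ ⋂ j, {x | j ≠ i → rank j = rank i → u j x < u i x}
  have hO (i : ι) : IsOpen (O i) := by
    refine (isOpen_lt continuous_const (hu i)).inter (isOpen_iInter_of_finite fun j => ?_)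
    by_cases h1 : j ≠ i
    · by_cases h2 : rank j = rank i
      · simpa [h1, h2] using isOpen_lt (hu j) (hu i)
      · simp [h2]
    · simp [h1]
  refine ⟨fun l => ⋃ i : {i // rank i = l}, O i, fun l => isOpen_iUnion fun i => hO i, ?_,
    fun l => inessential_iUnion (fun i => hO i) ?_ fun i => (hn i).mono inter_subset_left⟩
  · rw [eq_univ_iff_forall]
    intro x
    obtain ⟨i, hi, hpos, hz⟩ := hcov x
    refine mem_iUnion.2 ⟨⟨rank i, hi⟩, mem_iUnion.2 ⟨⟨i, rfl⟩, hpos, mem_iInter.2 fun j h1 h2 => ?_⟩⟩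
    rw [hz j h1 h2]
    exact hpos
  · intro i j hij
    have hij' : i.1 ≠ j.1 := fun h => hij (Subtype.ext h)
    refine Set.disjoint_left.2 fun x hi hj => ?_
    have h1 := mem_iInter.1 hi.2 j.1 hij'.symm (j.2.trans i.2.symm)
    have h2 := mem_iInter.1 hj.2 i.1 hij' (i.2.trans j.2.symm)
    exact lt_asymm h1 h2

end CategoricalCover

section PathConnected

instance (n : ℕ) : PathConnectedSpace (CP n) := by
  have h : 1 < Module.rank ℝ (Fin (n + 1) → ℂ) := by
    rw [← Module.finrank_eq_rank, Module.finrank_pi_fintype]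
    simp
    norm_cast
    omega
  have hc : IsPathConnected {v : Fin (n + 1) → ℂ | v ≠ 0} :=
    isPathConnected_compl_singleton_of_one_lt_rank h 0
  have : PathConnectedSpace {v : Fin (n + 1) → ℂ // v ≠ 0} :=
    isPathConnected_iff_pathConnectedSpace.1 hc
  exact CP.mk_surjective.pathConnectedSpace CP.continuous_mk

lemma pathConnectedSpace_sph {k : ℕ} (hk : 1 ≤ k) : PathConnectedSpace (Sph k) := by
  have h : 1 < Module.rank ℝ (EuclideanSpace ℝ (Fin (k + 1))) := by
    rw [← Module.finrank_eq_rank, finrank_euclideanSpace_fin]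
    norm_cast
    omega
  exact isPathConnected_iff_pathConnectedSpace.1 (isPathConnected_sphere h 0 zero_le_one)

lemma pathConnectedSpace_cpgpp {n r : ℕ} {m : Fin r → ℕ} (hm : ∀ i, 1 ≤ m i) :
    PathConnectedSpace (CPGPP n r m) := by
  have := fun i => pathConnectedSpace_sph (hm i)
  exact (coverProj_surjective (n := n) (m := m)).pathConnectedSpace continuous_coverProj

end PathConnected

lemma dirOf_coe {k : ℕ} (x : Sph k) : dirOf (x : EuclideanSpace ℝ (Fin (k + 1))) = x := by
  ext1
  rw [coe_dirOf (norm_ne_zero_iff.1 (by simp)), norm_coe_sph, inv_one, one_smul]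

lemma dirOf_smul {k : ℕ} {c : ℝ} (hc : 0 < c) {x : EuclideanSpace ℝ (Fin (k + 1))} (h : x ≠ 0) :
    dirOf (c • x) = dirOf x := by
  ext1
  rw [coe_dirOf h, coe_dirOf (smul_ne_zero hc.ne' h), norm_smul, Real.norm_of_nonneg hc.le,
    smul_smul, mul_inv, mul_right_comm, inv_mul_cancel₀ hc.ne', one_mul]

lemma lineOf_smul {n : ℕ} {c : ℂ} (hc : c ≠ 0) (w : Fin (n + 1) → ℂ) :
    lineOf (c • w) = lineOf w := by
  by_cases h : w = 0
  · simp [h]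
  · rw [lineOf_of_ne h, lineOf_of_ne (smul_ne_zero hc h)]
    exact (CP.mk_eq_iff.2 ⟨c, rfl⟩).symm

lemma CP.proj_self_re_nonneg {n : ℕ} (y : CP n) (j : Fin (n + 1)) : 0 ≤ (y.proj j j).re := by
  obtain ⟨v, rfl⟩ := CP.mk_surjective y
  have h (z : ℂ) : z * star z = ((Complex.normSq z : ℝ) : ℂ) := Complex.mul_conj z
  have h1 : star v.1 ⬝ᵥ v.1 = ((∑ i, Complex.normSq (v.1 i) : ℝ) : ℂ) := by
    simp only [dotProduct, Pi.star_apply, mul_comm (star _), h, Complex.ofReal_sum]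
  rw [CP.proj_mk, h, h1, ← Complex.ofReal_div, Complex.ofReal_re]
  exact div_nonneg (Complex.normSq_nonneg _) (Finset.sum_nonneg fun i _ => Complex.normSq_nonneg _)

lemma CP.proj_self_re_ne_zero_iff {n : ℕ} (v : {v : Fin (n + 1) → ℂ // v ≠ 0}) (j : Fin (n + 1)) :
    ((CP.mk v).proj j j).re ≠ 0 ↔ v.1 j ≠ 0 := by
  have h (z : ℂ) : z * star z = ((Complex.normSq z : ℝ) : ℂ) := Complex.mul_conj z
  have h1 : star v.1 ⬝ᵥ v.1 = ((∑ i, Complex.normSq (v.1 i) : ℝ) : ℂ) := by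
    simp only [dotProduct, Pi.star_apply, mul_comm (star _), h, Complex.ofReal_sum]
  have h2 := dotProduct_star_self_ne_zero v.2
  rw [h1, Complex.ofReal_ne_zero] at h2
  rw [CP.proj_mk, h, h1, ← Complex.ofReal_div, Complex.ofReal_re, div_ne_zero_iff, and_iff_left h2,
    ne_eq, Complex.normSq_eq_zero]

lemma CP.lineOf_proj {n : ℕ} {y : CP n} {j : Fin (n + 1)} (h : (y.proj j j).re ≠ 0) :
    lineOf (fun i => y.proj i j) = y := by
  obtain ⟨v, rfl⟩ := CP.mk_surjective y
  have hv := (CP.proj_self_re_ne_zero_iff v j).1 h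
  have h1 : (fun i => (CP.mk v).proj i j) = (star (v.1 j) / (star v.1 ⬝ᵥ v.1)) • v.1 := by
    funext i
    rw [CP.proj_mk, Pi.smul_apply, smul_eq_mul]
    ring
  rw [h1, lineOf_smul (div_ne_zero (star_ne_zero.2 hv) (dotProduct_star_self_ne_zero v.2)),
    lineOf_of_ne v.2]

/-- The sign attached to a label. -/
def labelSign (c : Fin 2) : ℝ := if c = 0 then 1 else -1

lemma labelSign_mul_self (c : Fin 2) : labelSign c * labelSign c = 1 := by
  unfold labelSign
  split_ifs <;> norm_num

section Cells

variable {n r : ℕ} {m : Fin r → ℕ} {i₀ : Fin r}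

/-- The labels of the sets covering the generalized projective product space. -/
abbrev Label (n : ℕ) (m : Fin r → ℕ) (i₀ : Fin r) : Type :=
  Fin (n + 1) × Fin (m i₀ + 1) × (Fin r → Fin 2)

variable (s : ∀ i, EuclideanSpace ℝ (Fin (m i₀ + 1)) →ₗᵢ[ℝ] EuclideanSpace ℝ (Fin (m i + 1)))

/-- The function on the double cover whose support is the set with the given label. -/
noncomputable def weight (J : Label n m i₀) (ξ : DoubleCover n r m) : ℝ :=
  (ξ.1.proj J.1 J.1).re * (ξ.2 i₀ : EuclideanSpace ℝ (Fin (m i₀ + 1))) J.2.1 ^ 2 *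
    ∏ i, (1 + labelSign (J.2.2 i) * inner ℝ (ξ.2 i : EuclideanSpace ℝ (Fin (m i + 1)))
      (s i (ξ.2 i₀)))

lemma weight_deck (J : Label n m i₀) (ξ : DoubleCover n r m) :
    weight s J (deck ξ) = weight s J ξ := by
  simp [weight, deck, CP.proj_cpConj]

lemma continuous_sph (i : Fin r) :
    Continuous fun ξ : DoubleCover n r m => (ξ.2 i : EuclideanSpace ℝ (Fin (m i + 1))) :=
  continuous_subtype_val.comp ((continuous_apply i).comp continuous_snd)

lemma continuous_weight (J : Label n m i₀) : Continuous (weight s J) := by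
  unfold weight
  refine ((Complex.continuous_re.comp ((CP.continuous_proj _ _).comp continuous_fst)).mul
    (((EuclideanSpace.proj (𝕜 := ℝ) J.2.1).continuous.comp (continuous_sph i₀)).pow 2)).mul
    (continuous_finsetProd _ fun i _ => ?_)
  exact continuous_const.add (continuous_const.mul
    ((continuous_sph i).inner ((s i).continuous.comp (continuous_sph i₀))))

lemma one_add_labelSign_mul_inner_nonneg (c : Fin 2) {E : Type*} [NormedAddCommGroup E]
    [InnerProductSpace ℝ E] {a b : E} (ha : ‖a‖ = 1) (hb : ‖b‖ = 1) :
    0 ≤ 1 + labelSign c * inner ℝ a b := by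
  have h := abs_real_inner_le_norm a b
  rw [ha, hb, one_mul, abs_le] at h
  unfold labelSign
  split_ifs <;> linarith

lemma weight_nonneg (J : Label n m i₀) (ξ : DoubleCover n r m) : 0 ≤ weight s J ξ :=
  mul_nonneg (mul_nonneg (CP.proj_self_re_nonneg _ _) (sq_nonneg _)) (Finset.prod_nonneg fun i _ =>
    one_add_labelSign_mul_inner_nonneg _ (norm_coe_sph _)
      (by rw [LinearIsometry.norm_map, norm_coe_sph]))

lemma weight_ne_zero_iff (J : Label n m i₀) (ξ : DoubleCover n r m) :
    weight s J ξ ≠ 0 ↔ (ξ.1.proj J.1 J.1).re ≠ 0 ∧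
      (ξ.2 i₀ : EuclideanSpace ℝ (Fin (m i₀ + 1))) J.2.1 ≠ 0 ∧
      ∀ i, 1 + labelSign (J.2.2 i) * inner ℝ (ξ.2 i : EuclideanSpace ℝ (Fin (m i + 1)))
        (s i (ξ.2 i₀)) ≠ 0 := by
  simp [weight, Finset.prod_ne_zero_iff, and_assoc]

/-- The deformation of a line to a coordinate line. -/
noncomputable def lineVec (j : Fin (n + 1)) (t : ℝ) (y : CP n) : Fin (n + 1) → ℂ :=
  fun i => ((if i = j then 1 else 1 - t : ℝ) : ℂ) * y.proj i j

/-- The deformation of a vector to a multiple of a basis vector. -/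
noncomputable def axisVec {k : ℕ} (j : Fin (k + 1)) (t : ℝ) (x : EuclideanSpace ℝ (Fin (k + 1))) :
    EuclideanSpace ℝ (Fin (k + 1)) :=
  WithLp.toLp 2 fun i => (if i = j then 1 else 1 - t) * x i

lemma lineVec_ne_zero {j : Fin (n + 1)} (t : ℝ) {y : CP n} (h : (y.proj j j).re ≠ 0) :
    lineVec j t y ≠ 0 := by
  intro h0
  have := congrFun h0 j
  simp only [lineVec, if_true, Complex.ofReal_one, one_mul, Pi.zero_apply] at this
  rw [this] at h
  exact h rfl

lemma continuous_lineVec (j : Fin (n + 1)) : Continuous fun q : ℝ × CP n => lineVec j q.1 q.2 := by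
  refine continuous_pi fun i => (Complex.continuous_ofReal.comp ?_).mul
    ((CP.continuous_proj i j).comp continuous_snd)
  split_ifs <;> fun_prop

lemma lineVec_cpConj (j : Fin (n + 1)) (t : ℝ) (y : CP n) :
    lineVec j t (cpConj n y) = star (lineVec j t y) := by
  funext i
  simp [lineVec, CP.proj_cpConj]

lemma axisVec_ne_zero {k : ℕ} {j : Fin (k + 1)} (t : ℝ) {x : EuclideanSpace ℝ (Fin (k + 1))}
    (h : x j ≠ 0) : axisVec j t x ≠ 0 := by
  intro h0
  have := congrArg (fun z : EuclideanSpace ℝ (Fin (k + 1)) => z j) h0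
  simp [axisVec] at this
  exact h this

lemma continuous_axisVec {k : ℕ} (j : Fin (k + 1)) :
    Continuous fun q : ℝ × EuclideanSpace ℝ (Fin (k + 1)) => axisVec j q.1 q.2 := by
  refine (PiLp.continuous_toLp 2 _).comp (continuous_pi fun i => Continuous.mul ?_ ?_)
  · split_ifs <;> fun_prop
  · fun_prop

lemma axisVec_neg {k : ℕ} (j : Fin (k + 1)) (t : ℝ) (x : EuclideanSpace ℝ (Fin (k + 1))) :
    axisVec j t (-x) = -axisVec j t x := by
  ext i
  simp [axisVec]

lemma axisVec_zero {k : ℕ} (j : Fin (k + 1)) (x : EuclideanSpace ℝ (Fin (k + 1))) :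
    axisVec j 0 x = x := by
  ext i
  simp [axisVec]

lemma axisVec_one {k : ℕ} (j : Fin (k + 1)) (x : EuclideanSpace ℝ (Fin (k + 1))) :
    axisVec j 1 x = x j • EuclideanSpace.single j 1 := by
  ext i
  by_cases h : i = j
  · subst h; simp [axisVec]
  · simp [axisVec, h]

/-- The vector whose direction is the `i`-th spherical coordinate of the contraction. -/
noncomputable def sphereVec (J : Label n m i₀) (t : ℝ) (ξ : DoubleCover n r m) (i : Fin r) :
    EuclideanSpace ℝ (Fin (m i + 1)) :=
  (1 - min (2 * t) 1) • (ξ.2 i : EuclideanSpace ℝ (Fin (m i + 1))) +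
    (min (2 * t) 1 * labelSign (J.2.2 i)) •
      s i (dirOf (axisVec J.2.1 (max 0 (2 * t - 1)) (ξ.2 i₀)))

/-- The contraction of the set with the given label. -/
noncomputable def contract (J : Label n m i₀) (q : ℝ × DoubleCover n r m) : DoubleCover n r m :=
  (lineOf (lineVec J.1 q.1 q.2.1), fun i => dirOf (sphereVec s J q.1 q.2 i))

/-- The point to which the set with the given label is contracted. -/
noncomputable def center (J : Label n m i₀) : DoubleCover n r m :=
  (lineOf (Pi.single J.1 1), fun i =>
    dirOf (labelSign (J.2.2 i) • s i (EuclideanSpace.single J.2.1 1)))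

lemma smul_add_ne_zero {E : Type*} [NormedAddCommGroup E] [InnerProductSpace ℝ E] {a b : E}
    (ha : ‖a‖ = 1) (hb : ‖b‖ = 1) (c : Fin 2) (h : 1 + labelSign c * inner ℝ a b ≠ 0) (t : ℝ) :
    (1 - t) • a + (t * labelSign c) • b ≠ 0 := by
  intro h0
  have h1 := congrArg (fun v => inner ℝ v (a + labelSign c • b)) h0
  have hcc := labelSign_mul_self c
  simp only [inner_add_left, inner_add_right, real_inner_smul_left, real_inner_smul_right,
    real_inner_self_eq_norm_sq, ha, hb, inner_zero_left, real_inner_comm a b] at h1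
  apply h
  linear_combination h1 - t * hcc

variable {s}

lemma sphereVec_ne_zero {J : Label n m i₀} {ξ : DoubleCover n r m} (h : weight s J ξ ≠ 0) (t : ℝ)
    (i : Fin r) : sphereVec s J t ξ i ≠ 0 := by
  have hw := (weight_ne_zero_iff s J ξ).1 h
  unfold sphereVec
  rcases le_total t (1 / 2) with ht | ht
  · rw [max_eq_left (by linarith), axisVec_zero, dirOf_coe]
    exact smul_add_ne_zero (norm_coe_sph _) (by rw [LinearIsometry.norm_map, norm_coe_sph]) _
      (hw.2.2 i) _
  · rw [min_eq_right (by linarith), sub_self, zero_smul, zero_add, one_mul]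
    refine smul_ne_zero (left_ne_zero_of_mul_eq_one (labelSign_mul_self _)) ?_
    rw [← norm_ne_zero_iff, LinearIsometry.norm_map, norm_coe_sph]
    exact one_ne_zero

lemma sphereVec_deck {J : Label n m i₀} {ξ : DoubleCover n r m} (h : weight s J ξ ≠ 0) (t : ℝ)
    (i : Fin r) : sphereVec s J t (deck ξ) i = -sphereVec s J t ξ i := by
  have hw := (weight_ne_zero_iff s J ξ).1 h
  simp only [sphereVec, deck, coe_negSph, axisVec_neg, dirOf_neg (axisVec_ne_zero _ hw.2.1),
    map_neg, smul_neg, neg_add]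

lemma contract_deck {J : Label n m i₀} {ξ : DoubleCover n r m} (h : weight s J ξ ≠ 0) (t : ℝ) :
    contract s J (t, deck ξ) = deck (contract s J (t, ξ)) := by
  have hw := (weight_ne_zero_iff s J ξ).1 h
  refine Prod.ext ?_ (funext fun i => ?_)
  · change lineOf (lineVec J.1 t (cpConj n ξ.1)) = cpConj n (lineOf (lineVec J.1 t ξ.1))
    rw [lineVec_cpConj, lineOf_star (lineVec_ne_zero t hw.1)]
  · change dirOf (sphereVec s J t (deck ξ) i) = negSph _ (dirOf (sphereVec s J t ξ i))
    rw [sphereVec_deck h, dirOf_neg (sphereVec_ne_zero h t i)]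

lemma continuousOn_contract (J : Label n m i₀) :
    ContinuousOn (contract s J) {q | weight s J q.2 ≠ 0} := by
  have h1 (i : Fin r) : Continuous fun q : ℝ × DoubleCover n r m =>
      (q.2.2 i : EuclideanSpace ℝ (Fin (m i + 1))) := (continuous_sph i).comp continuous_snd
  have h2 : ContinuousOn (fun q : ℝ × DoubleCover n r m =>
      dirOf (axisVec J.2.1 (max 0 (2 * q.1 - 1)) (q.2.2 i₀))) {q | weight s J q.2 ≠ 0} := by
    have h : Continuous fun q : ℝ × DoubleCover n r m => max 0 (2 * q.1 - 1) := by fun_prop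
    exact continuousOn_dirOf.comp
      ((continuous_axisVec J.2.1).comp (h.prodMk (h1 i₀))).continuousOn
      fun q hq => axisVec_ne_zero _ ((weight_ne_zero_iff s J q.2).1 hq).2.1
  refine ContinuousOn.prodMk (continuousOn_lineOf.comp ((continuous_lineVec J.1).comp
    (continuous_fst.prodMk (continuous_fst.comp continuous_snd))).continuousOn
    fun q hq => lineVec_ne_zero _ ((weight_ne_zero_iff s J q.2).1 hq).1)
    (continuousOn_pi.2 fun i => continuousOn_dirOf.comp ?_ fun q hq => sphereVec_ne_zero hq _ _)
  have h3 : Continuous fun q : ℝ × DoubleCover n r m => min (2 * q.1) 1 := by fun_prop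
  refine ((continuous_const.sub h3).smul (h1 i)).continuousOn.add
    ((h3.mul continuous_const).continuousOn.smul ?_)
  exact (s i).continuous.comp_continuousOn (continuous_subtype_val.comp_continuousOn h2)

lemma contract_zero {J : Label n m i₀} {ξ : DoubleCover n r m} (h : weight s J ξ ≠ 0) :
    contract s J (0, ξ) = ξ := by
  have hw := (weight_ne_zero_iff s J ξ).1 h
  refine Prod.ext ?_ (funext fun i => ?_)
  · have h1 : lineVec J.1 0 ξ.1 = fun i => ξ.1.proj i J.1 := by
      funext i
      simp [lineVec]
    change lineOf (lineVec J.1 0 ξ.1) = ξ.1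
    rw [h1, CP.lineOf_proj hw.1]
  · have h1 : sphereVec s J 0 ξ i = ξ.2 i := by simp [sphereVec]
    change dirOf (sphereVec s J 0 ξ i) = ξ.2 i
    rw [h1, dirOf_coe]

lemma contract_one {J : Label n m i₀} {ξ : DoubleCover n r m} (h : weight s J ξ ≠ 0) :
    coverProj (contract s J (1, ξ)) = coverProj (center s J) := by
  have hw := (weight_ne_zero_iff s J ξ).1 h
  have hc1 : (Pi.single J.1 1 : Fin (n + 1) → ℂ) ≠ 0 := by simp
  have hfst : (contract s J (1, ξ)).1 = (center s J).1 := by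
    have h1 : lineVec J.1 1 ξ.1 = ξ.1.proj J.1 J.1 • Pi.single J.1 1 := by
      funext i
      by_cases hi : i = J.1
      · subst hi; simp [lineVec]
      · simp [lineVec, hi]
    change lineOf (lineVec J.1 1 ξ.1) = lineOf (Pi.single J.1 1)
    rw [h1, lineOf_smul]
    intro h0
    exact hw.1 (by rw [h0]; rfl)
  have hconj : cpConj n (center s J).1 = (center s J).1 := by
    change cpConj n (lineOf (Pi.single J.1 1)) = lineOf (Pi.single J.1 1)
    rw [← lineOf_star hc1]
    congr 1
    funext i
    by_cases hi : i = J.1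
    · subst hi; simp
    · simp [hi]
  have hsph (i : Fin r) : sphereVec s J 1 ξ i = labelSign (J.2.2 i) •
      s i (dirOf ((ξ.2 i₀ : EuclideanSpace ℝ (Fin (m i₀ + 1))) J.2.1 •
        EuclideanSpace.single J.2.1 1)) := by
    have h1 : min (2 * 1 : ℝ) 1 = 1 := by norm_num
    have h2 : max 0 (2 * 1 - 1 : ℝ) = 1 := by norm_num
    simp only [sphereVec, h1, h2, axisVec_one, sub_self, zero_smul, zero_add, one_mul]
  have he : (EuclideanSpace.single J.2.1 1 : EuclideanSpace ℝ (Fin (m i₀ + 1))) ≠ 0 := by simp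
  have he' : (dirOf (EuclideanSpace.single J.2.1 (1 : ℝ)) : EuclideanSpace ℝ (Fin (m i₀ + 1))) =
      EuclideanSpace.single J.2.1 1 := by
    rw [coe_dirOf he]; simp
  rcases lt_or_gt_of_ne hw.2.1 with hx | hx
  · refine coverProj_eq_iff.2 (Or.inr (Prod.ext ?_ (funext fun i => ?_)))
    · change (center s J).1 = cpConj n (contract s J (1, ξ)).1
      rw [hfst, hconj]
    · change _ = negSph _ (dirOf (sphereVec s J 1 ξ i))
      rw [← dirOf_neg (sphereVec_ne_zero h 1 i), hsph,
        ← neg_neg ((ξ.2 i₀ : EuclideanSpace ℝ (Fin (m i₀ + 1))) J.2.1), neg_smul,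
        dirOf_neg (smul_ne_zero (neg_ne_zero.2 hw.2.1) he), dirOf_smul (neg_pos.2 hx) he,
        coe_negSph, he', map_neg, smul_neg, neg_neg]
      rfl
  · refine coverProj_eq_iff.2 (Or.inl (Prod.ext hfst.symm (funext fun i => ?_)))
    change _ = dirOf (sphereVec s J 1 ξ i)
    rw [hsph, dirOf_smul hx he, he']
    rfl

variable (s) in
/-- The function on the quotient induced by `weight`. -/
noncomputable def quotWeight (J : Label n m i₀) (x : CPGPP n r m) : ℝ :=
  Quot.lift (weight s J) (by rintro a b rfl; exact (weight_deck s J a).symm) x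

lemma continuous_quotWeight (J : Label n m i₀) : Continuous (quotWeight s J) :=
  isOpenQuotientMap_coverProj.isQuotientMap.continuous_iff.2 (continuous_weight s J)

lemma inessential_quotWeight_pos (J : Label n m i₀) : Inessential {x | 0 < quotWeight s J x} := by
  refine inessential_of_lift isOpenQuotientMap_coverProj (Φ := fun q => coverProj (contract s J q))
    ?_ (coverProj (center s J)) ?_ ?_ ?_
  · exact continuous_coverProj.comp_continuousOn ((continuousOn_contract J).mono
      fun q hq => ne_of_gt (show 0 < weight s J q.2 from hq))
  · intro t ξ ξ' hξ h
    have hξ' : weight s J ξ ≠ 0 := ne_of_gt hξ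
    rcases coverProj_eq_iff.1 h with rfl | rfl
    · rfl
    · rw [contract_deck hξ', coverProj_deck]
  · intro ξ hξ
    rw [contract_zero (ne_of_gt (show 0 < weight s J ξ from hξ))]
  · intro ξ hξ
    exact contract_one (ne_of_gt (show 0 < weight s J ξ from hξ))

end Cells

section Covering

variable {n r : ℕ} {m : Fin r → ℕ} {i₀ : Fin r}

/-- The rank of a label. -/
def labelRank (J : Label n m i₀) : ℕ := J.1 + (J.2.1 + ∑ i, (J.2.2 i : ℕ))

lemma exists_fin_minimal {k : ℕ} {P : Fin k → Prop} (h : ∃ i, P i) :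
    ∃ i, P i ∧ ∀ j, P j → i ≤ j := by
  classical
  exact ⟨Fin.find P h, Fin.find_spec h, fun j hj => Fin.find_le_of_pos h hj⟩

lemma exists_label (s : ∀ i, EuclideanSpace ℝ (Fin (m i₀ + 1)) →ₗᵢ[ℝ] EuclideanSpace ℝ (Fin (m i + 1)))
    (hs : s i₀ = LinearIsometry.id) (ξ : DoubleCover n r m) :
    ∃ J : Label n m i₀, labelRank J < n + m i₀ + r ∧ weight s J ξ ≠ 0 ∧
      ∀ J', J' ≠ J → labelRank J' = labelRank J → weight s J' ξ = 0 := by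
  obtain ⟨a, ha, ha'⟩ := exists_fin_minimal (P := fun j => (ξ.1.proj j j).re ≠ 0) (by
    obtain ⟨v, hv⟩ := CP.mk_surjective ξ.1
    obtain ⟨j, hj⟩ := Function.ne_iff.1 v.2
    exact ⟨j, by rw [← hv]; exact (CP.proj_self_re_ne_zero_iff v j).2 hj⟩)
  obtain ⟨b, hb, hb'⟩ := exists_fin_minimal
    (P := fun j => (ξ.2 i₀ : EuclideanSpace ℝ (Fin (m i₀ + 1))) j ≠ 0) (by
      by_contra! h
      have h0 : (ξ.2 i₀ : EuclideanSpace ℝ (Fin (m i₀ + 1))) = 0 := by ext j; exact h j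
      have h1 := norm_coe_sph (ξ.2 i₀)
      rw [h0, norm_zero] at h1
      exact zero_ne_one h1)
  have hc (i : Fin r) := exists_fin_minimal (P := fun c : Fin 2 => 1 + labelSign c *
    inner ℝ (ξ.2 i : EuclideanSpace ℝ (Fin (m i + 1))) (s i (ξ.2 i₀)) ≠ 0) (by
      by_contra! h
      have h0 := h 0
      have h1 := h 1
      simp only [labelSign, if_true, one_ne_zero, if_false] at h0 h1
      linarith)
  choose c hc hc' using hc
  have hc0 : c i₀ = 0 := by
    refine le_antisymm (hc' i₀ 0 ?_) (Fin.zero_le _)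
    rw [hs, LinearIsometry.id_apply, real_inner_self_eq_norm_sq, norm_coe_sph]
    norm_num [labelSign]
  refine ⟨(a, b, c), ?_, (weight_ne_zero_iff s _ ξ).2 ⟨ha, hb, hc⟩, ?_⟩
  · have hsum : ∑ i, (c i : ℕ) < r := by
      calc ∑ i, (c i : ℕ) < ∑ _i : Fin r, 1 :=
            Finset.sum_lt_sum (fun i _ => Nat.le_of_lt_succ (c i).2)
              ⟨i₀, Finset.mem_univ _, by rw [hc0]; exact zero_lt_one⟩
        _ = r := by simp
    have h1 := a.2
    have h2 := b.2
    simp only [labelRank]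
    omega
  · rintro ⟨a', b', c'⟩ hne hrank
    by_contra hw
    obtain ⟨h1, h2, h3⟩ := (weight_ne_zero_iff s _ ξ).1 hw
    have ha1 : (a : ℕ) ≤ a' := ha' a' h1
    have hb1 : (b : ℕ) ≤ b' := hb' b' h2
    have hc1 (i : Fin r) : (c i : ℕ) ≤ c' i := hc' i (c' i) (h3 i)
    have hsum : ∑ i, (c i : ℕ) ≤ ∑ i, (c' i : ℕ) := Finset.sum_le_sum fun i _ => hc1 i
    simp only [labelRank] at hrank
    have hcc := (Finset.sum_eq_sum_iff_of_le fun i _ => hc1 i).1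
      (show ∑ i, (c i : ℕ) = ∑ i, (c' i : ℕ) by omega)
    refine hne (Prod.ext (Fin.ext (by dsimp only; omega)) (Prod.ext (Fin.ext (by dsimp only; omega))
      (funext fun i => Fin.ext (hcc i (Finset.mem_univ _)).symm)))

lemma hasCatCover_cpgpp (hm1 : ∀ i, 1 ≤ m i) (hm : ∀ i, m i₀ ≤ m i) :
    HasCatCover (CPGPP n r m) (n + m i₀ + r) := by
  have := pathConnectedSpace_cpgpp (n := n) hm1
  have hex (i : Fin r) := exists_linearIsometry_euclidean (Nat.add_le_add_right (hm i) 1)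
  let s := Function.update (β := fun i =>
    EuclideanSpace ℝ (Fin (m i₀ + 1)) →ₗᵢ[ℝ] EuclideanSpace ℝ (Fin (m i + 1)))
    (fun i => (hex i).some) i₀ LinearIsometry.id
  have hs : s i₀ = LinearIsometry.id := Function.update_self ..
  refine hasCatCover_of_weights labelRank (u := quotWeight s) continuous_quotWeight ?_
    inessential_quotWeight_pos
  intro x
  obtain ⟨ξ, rfl⟩ := coverProj_surjective x
  obtain ⟨J, h1, h2, h3⟩ := exists_label s hs ξ
  exact ⟨J, h1, (weight_nonneg s J ξ).lt_of_ne' h2, h3⟩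

end Covering

/-- **LS-category of `X(ℂP^n, n_1, …, n_r)`.**  For integers `2 ≤ n_1 ≤ ⋯ ≤ n_r`,
`cat(X(ℂP^n, n_1, …, n_r)) = n + n_1 + r`. -/
theorem cat_cpgpp (n r : ℕ) (hr : 0 < r) (m : Fin r → ℕ)
    (hm2 : 2 ≤ m ⟨0, hr⟩) (hmono : Monotone m) :
    cat (CPGPP n r m) = (n + m ⟨0, hr⟩ + r : ℕ) := by
  have hm : ∀ i, m ⟨0, hr⟩ ≤ m i := fun i => hmono (Nat.zero_le _)
  refine le_antisymm (sInf_le ⟨_, rfl, hasCatCover_cpgpp (fun i => ?_) hm⟩) (le_sInf ?_)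
  · exact one_le_two.trans (hm2.trans (hm i))
  · rintro _ ⟨k, rfl, hk⟩
    exact Nat.cast_le.2 (le_of_hasCatCover ⟨0, hr⟩ hm hk)

end Paper
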